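/- arXiv:0810.2137 — 9 statements merged into one kernel-verified Lean document; each statement's English description precedes it below -/
import Mathlib

section
/- For every γ ∈ (1,∞), ρ_u > 0, c_u > 0 and u_n > c_u there exists a unique ρ_d ∈ (ρ_u, ∞) satisfying (c_u²/(γ−1))·((ρ_d/ρ_u)^{γ−1} − 1) = (u_n²/2)·(1 − (ρ_u/ρ_d)²). Moreover, setting u_d := ρ_u·u_n/ρ_d and c_d := c_u·(ρ_d/ρ_u)^{(γ−1)/2}, one has 0 < u_d < u_n, c_d > c_u, and u_d < c_d (the downstream normal velocity is subsonic). -/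
/-- The Bernoulli defect across a shock with density ratio `x`, where `a = γ - 1`. -/
noncomputable def bernoulliDefect (a c u x : ℝ) : ℝ :=
  c ^ 2 / a * (x ^ a - 1) - u ^ 2 / 2 * (1 - (x ^ 2)⁻¹)

theorem bernoulliDefect_one (a c u : ℝ) : bernoulliDefect a c u 1 = 0 := by
  simp [bernoulliDefect]

theorem hasDerivAt_bernoulliDefect {a x : ℝ} (c u : ℝ) (ha : 0 < a) (hx : 0 < x) :
    HasDerivAt (bernoulliDefect a c u) ((c ^ 2 * x ^ (a + 2) - u ^ 2) / x ^ 3) x := by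
  have h1 := (((Real.hasDerivAt_rpow_const (p := a) (Or.inl hx.ne')).sub_const 1).const_mul
    (c ^ 2 / a)).sub ((((hasDerivAt_pow 2 x).inv (pow_ne_zero 2 hx.ne')).const_sub 1).const_mul
    (u ^ 2 / 2))
  refine h1.congr_deriv ?_
  have h2 : x ^ (a + 2) = x ^ (a - 1) * x ^ 3 := by
    rw [← Real.rpow_natCast, ← Real.rpow_add hx]
    norm_num
    ring_nf
  rw [h2]
  field_simp
  push_cast
  ring

theorem strictAntiOn_bernoulliDefect {a c u s : ℝ} (ha : 0 < a) (hc : 0 < c)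
    (hs : c ^ 2 * s ^ (a + 2) = u ^ 2) :
    StrictAntiOn (bernoulliDefect a c u) (Set.Icc 1 s) := by
  refine strictAntiOn_of_deriv_neg (convex_Icc 1 s) (fun x hx ↦
    (hasDerivAt_bernoulliDefect c u ha (by linarith [hx.1])).continuousAt.continuousWithinAt) ?_
  intro x hx
  rw [interior_Icc] at hx
  have hx0 : 0 < x := by linarith [hx.1]
  rw [(hasDerivAt_bernoulliDefect c u ha hx0).deriv, ← hs]
  refine div_neg_of_neg_of_pos (sub_neg.2 ?_) (by positivity)
  have := Real.rpow_lt_rpow hx0.le hx.2 (by linarith : 0 < a + 2)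
  gcongr

theorem strictMonoOn_bernoulliDefect {a c u s : ℝ} (ha : 0 < a) (hc : 0 < c) (hs0 : 0 < s)
    (hs : c ^ 2 * s ^ (a + 2) = u ^ 2) :
    StrictMonoOn (bernoulliDefect a c u) (Set.Ici s) := by
  refine strictMonoOn_of_deriv_pos (convex_Ici s) (fun x hx ↦
    (hasDerivAt_bernoulliDefect c u ha
      (hs0.trans_le hx)).continuousAt.continuousWithinAt) ?_
  intro x hx
  rw [interior_Ici] at hx
  have hx0 : 0 < x := hs0.trans hx
  rw [(hasDerivAt_bernoulliDefect c u ha hx0).deriv, ← hs]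
  refine div_pos (sub_pos.2 ?_) (by positivity)
  have := Real.rpow_lt_rpow hs0.le hx (by linarith : 0 < a + 2)
  gcongr

theorem exists_sonic_ratio {a c u : ℝ} (ha : 0 < a) (hc : 0 < c) (hu : c < u) :
    ∃ s : ℝ, 1 < s ∧ c ^ 2 * s ^ (a + 2) = u ^ 2 := by
  have h1 : 1 < u ^ 2 / c ^ 2 := by
    rw [one_lt_div (by positivity)]
    gcongr
  refine ⟨(u ^ 2 / c ^ 2) ^ (a + 2)⁻¹, Real.one_lt_rpow h1 (by positivity), ?_⟩
  rw [Real.rpow_inv_rpow (by positivity) (by positivity)]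
  field_simp

/-- A nontrivial zero of the Bernoulli defect lies beyond the sonic ratio. -/
theorem sonic_lt_of_bernoulliDefect_eq_zero {a c u s x : ℝ} (ha : 0 < a) (hc : 0 < c)
    (hs1 : 1 < s) (hs : c ^ 2 * s ^ (a + 2) = u ^ 2) (hx : 1 < x)
    (h : bernoulliDefect a c u x = 0) : s < x := by
  by_contra! hxs
  have := strictAntiOn_bernoulliDefect ha hc hs ⟨le_rfl, hs1.le⟩ ⟨hx.le, hxs⟩ hx
  rw [h, bernoulliDefect_one] at this
  exact this.false

theorem exists_bernoulliDefect_eq_zero {a c u : ℝ} (ha : 0 < a) (hc : 0 < c) (hu : c < u) :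
    ∃ x : ℝ, 1 < x ∧ bernoulliDefect a c u x = 0 := by
  obtain ⟨s, hs1, hs⟩ := exists_sonic_ratio ha hc hu
  have hneg : bernoulliDefect a c u s < 0 := by
    rw [← bernoulliDefect_one a c u]
    exact strictAntiOn_bernoulliDefect ha hc hs ⟨le_rfl, hs1.le⟩ ⟨hs1.le, le_rfl⟩ hs1
  have hu0 : 0 < u := hc.trans hu
  obtain ⟨t, hst, ht⟩ : ∃ t, s ≤ t ∧ 0 ≤ bernoulliDefect a c u t := by
    obtain ⟨t, hst, ht⟩ := ((Filter.eventually_ge_atTop s).and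
      ((tendsto_rpow_atTop ha).eventually_ge_atTop (1 + a * u ^ 2 / (2 * c ^ 2)))).exists
    refine ⟨t, hst, ?_⟩
    have h1 : u ^ 2 / 2 ≤ c ^ 2 / a * (t ^ a - 1) :=
      calc u ^ 2 / 2 = c ^ 2 / a * (a * u ^ 2 / (2 * c ^ 2)) := by field_simp
        _ ≤ _ := by gcongr; linarith
    have h2 : 0 ≤ u ^ 2 / 2 * (t ^ 2)⁻¹ := by positivity
    unfold bernoulliDefect
    linarith
  obtain ⟨x, hx, hx0⟩ := intermediate_value_Icc hst (fun x hx ↦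
    (hasDerivAt_bernoulliDefect c u ha
      (by linarith [hx.1] : 0 < x)).continuousAt.continuousWithinAt) ⟨hneg.le, ht⟩
  exact ⟨x, hs1.trans_le hx.1, hx0⟩

/-- Existence and uniqueness of the downstream density of a steady
admissible shock in polytropic potential flow, determined by the Rankine–Hugoniot and
Bernoulli conditions, together with the basic properties of the downstream state:
`0 < u_d < u_n`, `c_d > c_u` and `u_d < c_d` (downstream normal velocity is subsonic). -/
theorem stmt_0 (γ ρu cu un : ℝ) (hγ : 1 < γ) (hρu : 0 < ρu) (hcu : 0 < cu)
    (hun : cu < un) :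
    (∃! ρd : ℝ, ρd ∈ Set.Ioi ρu ∧
        cu ^ 2 / (γ - 1) * ((ρd / ρu) ^ (γ - 1) - 1)
          = un ^ 2 / 2 * (1 - (ρu / ρd) ^ 2)) ∧
    ∀ ρd : ℝ, ρd ∈ Set.Ioi ρu →
      cu ^ 2 / (γ - 1) * ((ρd / ρu) ^ (γ - 1) - 1)
          = un ^ 2 / 2 * (1 - (ρu / ρd) ^ 2) →
      0 < ρu * un / ρd ∧ ρu * un / ρd < un ∧
        cu < cu * (ρd / ρu) ^ ((γ - 1) / 2) ∧
        ρu * un / ρd < cu * (ρd / ρu) ^ ((γ - 1) / 2) := by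
  have ha : 0 < γ - 1 := by linarith
  have hun0 : 0 < un := hcu.trans hun
  obtain ⟨s, hs1, hs⟩ := exists_sonic_ratio ha hcu hun
  have hiff (ρd : ℝ) : cu ^ 2 / (γ - 1) * ((ρd / ρu) ^ (γ - 1) - 1)
      = un ^ 2 / 2 * (1 - (ρu / ρd) ^ 2) ↔ bernoulliDefect (γ - 1) cu un (ρd / ρu) = 0 := by
    rw [bernoulliDefect, sub_eq_zero, ← inv_pow, inv_div]
  have hsonic {ρd : ℝ} (hρd : ρu < ρd)
      (h : bernoulliDefect (γ - 1) cu un (ρd / ρu) = 0) : s < ρd / ρu :=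
    sonic_lt_of_bernoulliDefect_eq_zero ha hcu hs1 hs ((one_lt_div hρu).2 hρd) h
  simp only [hiff, Set.mem_Ioi]
  refine ⟨?_, fun ρd hρd h ↦ ?_⟩
  · obtain ⟨x, hx1, hx⟩ := exists_bernoulliDefect_eq_zero ha hcu hun
    have hxρ : x * ρu / ρu = x := mul_div_cancel_right₀ x hρu.ne'
    refine ⟨x * ρu, ⟨lt_mul_of_one_lt_left hρu hx1, by rw [hxρ, hx]⟩, ?_⟩
    rintro y ⟨hy1, hy⟩
    rw [← div_eq_iff hρu.ne']
    exact (strictMonoOn_bernoulliDefect ha hcu (zero_lt_one.trans hs1) hs).injOn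
      (hsonic hy1 hy).le
      (sonic_lt_of_bernoulliDefect_eq_zero ha hcu hs1 hs hx1 hx).le (hy.trans hx.symm)
  · have hρd0 : 0 < ρd := hρu.trans hρd
    have hx1 : 1 < ρd / ρu := (one_lt_div hρu).2 hρd
    have hsx := hsonic hρd h
    refine ⟨by positivity, ?_, lt_mul_of_one_lt_right hcu (Real.one_lt_rpow hx1 (by linarith)), ?_⟩
    · rw [div_lt_iff₀ hρd0, mul_comm un]
      gcongr
    · have hu : ρu * un / ρd = un / (ρd / ρu) := by field_simp
      rw [hu]
      generalize ρd / ρu = x at hx1 hsx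
      have hx0 : 0 < x := by linarith
      rw [div_lt_iff₀ hx0]
      refine lt_of_pow_lt_pow_left₀ 2 (by positivity) ?_
      have hpow : (cu * x ^ ((γ - 1) / 2) * x) ^ 2 = cu ^ 2 * x ^ (γ - 1 + 2) := by
        rw [Real.rpow_add hx0, Real.rpow_two, mul_pow, mul_pow, ← Real.rpow_mul_natCast hx0.le]
        norm_num
        ring
      rw [hpow, ← hs]
      have := Real.rpow_lt_rpow (by linarith) hsx (by linarith : 0 < γ - 1 + 2)
      gcongr
end

section
/- Fix γ ∈ (1,∞). On the open set P := {(ρ_u, c_u, u_n) ∈ ℝ³ : ρ_u > 0, c_u > 0, u_n > c_u}, the map D : P → ℝ assigning to (ρ_u, c_u, u_n) the unique ρ_d ∈ (ρ_u, ∞) with (c_u²/(γ−1))·((ρ_d/ρ_u)^{γ−1} − 1) = (u_n²/2)·(1 − (ρ_u/ρ_d)²) is infinitely differentiable. In particular, at the solution ρ_d the derivative with respect to ρ_d of the function ρ ↦ (c_u²/(γ−1))((ρ/ρ_u)^{γ−1} − 1) − (u_n²/2)(1 − (ρ_u/ρ)²) equals (c_d² − u_d²)/ρ_d > 0, where u_d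 := ρ_u u_n/ρ_d and c_d := c_u(ρ_d/ρ_u)^{(γ−1)/2}, so the implicit function theorem applies. -/
/-- For a strictly convex power, the shock relation in the variable `t ^ 2` says that a secant
slope from `1` is prescribed; hence the compression ratio `t > 1` is unique. -/
lemma shock_ratio_unique {a k s t : ℝ} (ha : 0 < a) (hs : 1 < s) (ht : 1 < t)
    (hks : s ^ a - 1 = k * (1 - s⁻¹ ^ 2)) (hkt : t ^ a - 1 = k * (1 - t⁻¹ ^ 2)) : s = t := by
  have slope {t : ℝ} (ht : 1 < t) (h : t ^ a - 1 = k * (1 - t⁻¹ ^ 2)) :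
      ((t ^ 2) ^ (1 + a / 2) - (1 : ℝ) ^ (1 + a / 2)) / (t ^ 2 - 1) = 1 + k := by
    have h0 : 0 < t := by linarith
    have hpow : (t ^ 2) ^ (1 + a / 2) = t ^ 2 * t ^ a := by
      rw [← Real.rpow_natCast_mul h0.le, ← Real.rpow_natCast t 2, ← Real.rpow_add h0]
      congr 1
      push_cast
      ring
    have h1 : t ^ 2 - 1 ≠ 0 := by nlinarith
    rw [hpow, Real.one_rpow, div_eq_iff h1, sub_eq_iff_eq_add.mp h]
    field_simp
    ring
  have mono {s t : ℝ} (hs : 1 < s) (hst : s < t) :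
      ((s ^ 2) ^ (1 + a / 2) - (1 : ℝ) ^ (1 + a / 2)) / (s ^ 2 - 1) <
        ((t ^ 2) ^ (1 + a / 2) - (1 : ℝ) ^ (1 + a / 2)) / (t ^ 2 - 1) :=
    (strictConvexOn_rpow (p := 1 + a / 2) (by linarith)).secant_strict_mono
      (Set.mem_Ici.2 zero_le_one) (Set.mem_Ici.2 (sq_nonneg s)) (Set.mem_Ici.2 (sq_nonneg t))
      (by nlinarith) (by nlinarith) (by nlinarith)
  rcases lt_trichotomy s t with h | h | h
  · have := mono hs h
    rw [slope hs hks, slope ht hkt] at this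
    exact absurd this (lt_irrefl _)
  · exact h
  · have := mono ht h
    rw [slope hs hks, slope ht hkt] at this
    exact absurd this (lt_irrefl _)

/-- The flow behind a compressive shock is subsonic relative to the shock normal. -/
lemma shock_downstream_subsonic {a c u t : ℝ} (ha : 0 < a) (hu : u ≠ 0) (ht : 1 < t)
    (h : c ^ 2 / a * (t ^ a - 1) = u ^ 2 / 2 * (1 - t⁻¹ ^ 2)) :
    (u / t) ^ 2 < c ^ 2 * t ^ a := by
  have h0 : 0 < t := by linarith
  have hY : 1 < t ^ a := Real.one_lt_rpow ht ha
  have h1 : 1 - (t ^ a)⁻¹ ≤ a * Real.log t := by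
    rw [← Real.log_rpow h0]
    exact Real.one_sub_inv_le_log_of_pos (by linarith)
  have h2 : 2 * Real.log t < t ^ 2 - 1 := by
    have := Real.log_lt_sub_one_of_pos (show 0 < t ^ 2 by positivity) (by nlinarith)
    rwa [Real.log_pow, Nat.cast_ofNat] at this
  have h3 : 2 * (1 - (t ^ a)⁻¹) < a * (t ^ 2 - 1) := by nlinarith
  generalize t ^ a = Y at *
  have hY0 : 0 < Y := by linarith
  have h4 : 2 * (Y - 1) < a * (t ^ 2 - 1) * Y := by
    have := mul_lt_mul_of_pos_right h3 hY0
    have e : 2 * (1 - Y⁻¹) * Y = 2 * (Y - 1) := by field_simp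
    linarith
  have h5 : 2 * c ^ 2 * t ^ 2 * (Y - 1) = a * u ^ 2 * (t ^ 2 - 1) := by
    field_simp at h
    linarith
  have hu2 : 0 < u ^ 2 := by positivity
  rw [div_pow, div_lt_iff₀ (by positivity)]
  have h6 : u ^ 2 * (2 * (Y - 1)) < c ^ 2 * Y * t ^ 2 * (2 * (Y - 1)) := by
    have := mul_lt_mul_of_pos_left h4 hu2
    have e : c ^ 2 * Y * t ^ 2 * (2 * (Y - 1)) = u ^ 2 * (a * (t ^ 2 - 1) * Y) := by
      linear_combination Y * h5
    linarith
  exact lt_of_mul_lt_mul_right h6 (by linarith)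

/-- The derivative of the shock relation in the downstream density. -/
lemma hasDerivAt_shock_relation {γ r c u ρ : ℝ} (hγ : γ ≠ 1) (hr : 0 < r) (hρ : 0 < ρ) :
    HasDerivAt
      (fun ρ : ℝ => c ^ 2 / (γ - 1) * ((ρ / r) ^ (γ - 1) - 1) - u ^ 2 / 2 * (1 - (r / ρ) ^ 2))
      (((c * (ρ / r) ^ ((γ - 1) / 2)) ^ 2 - (r * u / ρ) ^ 2) / ρ) ρ := by
  have hγ' : γ - 1 ≠ 0 := sub_ne_zero.2 hγ
  have hq : 0 < ρ / r := by positivity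
  have h1 := (((hasDerivAt_id' ρ).div_const r).rpow_const (p := γ - 1) (Or.inl hq.ne')).sub_const 1
  have h2 := (((hasDerivAt_const ρ r).fun_div (hasDerivAt_id' ρ) hρ.ne').fun_pow 2).const_sub 1
  refine ((h1.const_mul (c ^ 2 / (γ - 1))).sub (h2.const_mul (u ^ 2 / 2))).congr_deriv ?_
  have e1 : ((ρ / r) ^ ((γ - 1) / 2)) ^ 2 = (ρ / r) ^ (γ - 1) := by
    rw [← Real.rpow_mul_natCast hq.le]
    congr 1
    push_cast
    ring
  rw [mul_pow, e1, Real.rpow_sub_one hq.ne']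
  simp only [Nat.add_one_sub_one, pow_one]
  field_simp
  ring

/-- A continuous linear endomorphism of the line is invertible if it does not kill `1`. -/
lemma isInvertible_of_apply_one_ne_zero {L : ℝ →L[ℝ] ℝ} (h : L 1 ≠ 0) : L.IsInvertible :=
  ⟨ContinuousLinearEquiv.unitsEquivAut ℝ (Units.mk0 (L 1) h), by ext; simp⟩

/-- A function which locally selects the zeros of `f (x, ·)` in an open set `U`, where these are
unique, is as smooth as `f` at points where the vertical derivative of `f` does not vanish. -/
lemma contDiffAt_of_unique_zero {E : Type*} [NormedAddCommGroup E] [NormedSpace ℝ E]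
    [CompleteSpace E] {n : WithTop ℕ∞} (hn : n ≠ 0) {f : E × ℝ → ℝ} {D : E → ℝ} {x : E} {d : ℝ}
    {U : Set (E × ℝ)} (hU : U ∈ nhds (x, D x)) (hf : ContDiffAt ℝ n f (x, D x))
    (hd : HasDerivAt (fun y => f (x, y)) d (D x)) (hd0 : d ≠ 0) (hfx : f (x, D x) = 0)
    (huniq : ∀ z ∈ U, f z = 0 → D z.1 = z.2) : ContDiffAt ℝ n D x := by
  have hinv : (fderiv ℝ f (x, D x) ∘L .inr ℝ E ℝ).IsInvertible := by
    apply isInvertible_of_apply_one_ne_zero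
    have hf' := (hf.differentiableAt hn).hasFDerivAt
    have := (hf'.comp_hasDerivAt (D x)
      ((hasDerivAt_const (D x) x).prodMk (hasDerivAt_id' (D x)))).unique hd
    simpa [this] using hd0
  have hψ := hf.contDiffAt_implicitFunction hn hinv
  refine hψ.congr_of_eventuallyEq ?_
  have hgraph : Filter.Tendsto (fun y => (y, hf.implicitFunction hn hinv y)) (nhds x)
      (nhds (x, D x)) := by
    have hc : ContinuousAt (fun y => (y, hf.implicitFunction hn hinv y)) x :=
      continuousAt_id.prodMk hψ.continuousAt
    have hx := hf.implicitFunction_apply_self hn hinv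
    simpa only [ContinuousAt, hx] using hc
  filter_upwards [hf.eventually_apply_implicitFunction hn hinv, hgraph hU] with y hy hyU
  exact huniq _ hyU (hy.trans hfx)

/-- Fix `γ ∈ (1,∞)`. On the open parameter set
`P = {(ρu, cu, un) : ρu > 0, cu > 0, un > cu}`, any map `D` selecting the downstream
density `ρd ∈ (ρu, ∞)` of the shock (i.e. the solution of the Rankine–Hugoniot/Bernoulli
relation) is infinitely differentiable; moreover, at the solution the derivative of the
defining function with respect to `ρd` equals `(c_d² − u_d²)/ρd > 0`, where
`u_d = ρu·un/ρd` and `c_d = cu·(ρd/ρu)^((γ−1)/2)`, so the implicit function theorem applies. -/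
theorem stmt_1 (γ : ℝ) (hγ : 1 < γ)
    (P : Set (ℝ × ℝ × ℝ))
    (hP : P = {p : ℝ × ℝ × ℝ | 0 < p.1 ∧ 0 < p.2.1 ∧ p.2.1 < p.2.2})
    (D : ℝ × ℝ × ℝ → ℝ)
    (hD : ∀ p ∈ P, p.1 < D p ∧
        p.2.1 ^ 2 / (γ - 1) * ((D p / p.1) ^ (γ - 1) - 1)
          = p.2.2 ^ 2 / 2 * (1 - (p.1 / D p) ^ 2)) :
    ContDiffOn ℝ (⊤ : ℕ∞) D P ∧
    ∀ p ∈ P,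
      HasDerivAt
        (fun ρ : ℝ => p.2.1 ^ 2 / (γ - 1) * ((ρ / p.1) ^ (γ - 1) - 1)
            - p.2.2 ^ 2 / 2 * (1 - (p.1 / ρ) ^ 2))
        (((p.2.1 * (D p / p.1) ^ ((γ - 1) / 2)) ^ 2 - (p.1 * p.2.2 / D p) ^ 2) / D p)
        (D p) ∧
      0 < ((p.2.1 * (D p / p.1) ^ ((γ - 1) / 2)) ^ 2 - (p.1 * p.2.2 / D p) ^ 2) / D p := by
  have hγ1 : 0 < γ - 1 := sub_pos.2 hγ
  have hderiv : ∀ p ∈ P, HasDerivAt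
      (fun ρ : ℝ => p.2.1 ^ 2 / (γ - 1) * ((ρ / p.1) ^ (γ - 1) - 1)
          - p.2.2 ^ 2 / 2 * (1 - (p.1 / ρ) ^ 2))
      (((p.2.1 * (D p / p.1) ^ ((γ - 1) / 2)) ^ 2 - (p.1 * p.2.2 / D p) ^ 2) / D p) (D p) ∧
      0 < ((p.2.1 * (D p / p.1) ^ ((γ - 1) / 2)) ^ 2 - (p.1 * p.2.2 / D p) ^ 2) / D p := by
    intro p hp
    obtain ⟨hlt, heq⟩ := hD p hp
    rw [hP] at hp
    obtain ⟨hr, hc, hu⟩ := hp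
    have hρ : 0 < D p := hr.trans hlt
    refine ⟨hasDerivAt_shock_relation hγ.ne' hr hρ, div_pos (sub_pos.2 ?_) hρ⟩
    rw [← inv_div (D p) p.1] at heq
    have := shock_downstream_subsonic hγ1 (hc.trans hu).ne' ((one_lt_div hr).2 hlt) heq
    rw [mul_pow, ← Real.rpow_mul_natCast (by positivity), Nat.cast_ofNat,
      div_mul_cancel₀ _ two_ne_zero]
    rwa [div_div_eq_mul_div, mul_comm p.2.2] at this
  refine ⟨fun p hp => ContDiffAt.contDiffWithinAt ?_, hderiv⟩
  have hopen : IsOpen {z : (ℝ × ℝ × ℝ) × ℝ | z.1 ∈ P ∧ z.1.1 < z.2} := by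
    subst hP
    exact ((isOpen_lt (f := fun _ => (0 : ℝ)) (g := fun z : (ℝ × ℝ × ℝ) × ℝ => z.1.1)
      (by fun_prop) (by fun_prop)).inter
      ((isOpen_lt (f := fun _ => (0 : ℝ)) (g := fun z : (ℝ × ℝ × ℝ) × ℝ => z.1.2.1)
      (by fun_prop) (by fun_prop)).inter
      (isOpen_lt (f := fun z : (ℝ × ℝ × ℝ) × ℝ => z.1.2.1) (g := fun z => z.1.2.2)
      (by fun_prop) (by fun_prop)))).inter
      (isOpen_lt (f := fun z : (ℝ × ℝ × ℝ) × ℝ => z.1.1) (g := fun z => z.2)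
      (by fun_prop) (by fun_prop))
  obtain ⟨hlt, heq⟩ := hD p hp
  have hr : 0 < p.1 := by rw [hP] at hp; exact hp.1
  have hρ : 0 < D p := hr.trans hlt
  refine contDiffAt_of_unique_zero (by simp)
    (f := fun z => z.1.2.1 ^ 2 / (γ - 1) * ((z.2 / z.1.1) ^ (γ - 1) - 1)
      - z.1.2.2 ^ 2 / 2 * (1 - (z.1.1 / z.2) ^ 2))
    (hopen.mem_nhds ⟨hp, hlt⟩) ?_ (hderiv p hp).1 (hderiv p hp).2.ne' (sub_eq_zero.2 heq) ?_
  · have h1 : ContDiffAt ℝ (⊤ : ℕ∞) (fun z : (ℝ × ℝ × ℝ) × ℝ => z.2 / z.1.1) (p, D p) :=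
      ContDiffAt.div (by fun_prop) (by fun_prop) hr.ne'
    have h2 : ContDiffAt ℝ (⊤ : ℕ∞) (fun z : (ℝ × ℝ × ℝ) × ℝ => z.1.1 / z.2) (p, D p) :=
      ContDiffAt.div (by fun_prop) (by fun_prop) hρ.ne'
    have h3 := h1.rpow_const_of_ne (p := γ - 1) (div_pos hρ hr).ne'
    fun_prop
  · rintro ⟨q, y⟩ ⟨hq, hy⟩ hz
    obtain ⟨hqlt, hqeq⟩ := hD q hq
    rw [hP] at hq
    obtain ⟨hq1, hq2, -⟩ := hq
    have hz' := sub_eq_zero.1 hz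
    have scale {t : ℝ} (h : q.2.1 ^ 2 / (γ - 1) * ((t / q.1) ^ (γ - 1) - 1)
        = q.2.2 ^ 2 / 2 * (1 - (q.1 / t) ^ 2)) :
        (t / q.1) ^ (γ - 1) - 1 =
          q.2.2 ^ 2 / 2 / (q.2.1 ^ 2 / (γ - 1)) * (1 - (t / q.1)⁻¹ ^ 2) := by
      rw [inv_div, div_mul_eq_mul_div, eq_div_iff (by positivity), ← h, mul_comm]
    exact (div_left_inj' hq1.ne').1 (shock_ratio_unique hγ1 ((one_lt_div hq1).2 hqlt)
      ((one_lt_div hq1).2 hy) (scale hqeq) (scale hz'))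
end

section
/- Let I ⊆ ℝ be an interval and let v^t, v_u^n, c, M : I → ℝ be differentiable functions with c > 0 and c' ≥ 0, v_u^n > 0 and (v_u^n)' ≥ 0, v^t > 0 and (v^t)' ≤ 0, 0 < M < 1 and M' ≤ 0 on I. Define A := v^t·(1/v_u^n + M/c)/(1 − M²) and, for β ∈ I, n(β) := (cos β, sin β), t(β) := (−sin β, cos β), q(β) := n(β) − A(β)·t(β). Then A is differentiable with A' ≤ 0 on I, and the planar cross product satisfies q(β) × q'(β) = 1 − A'(β) + A(β)² ≥ 1 + A(β)² > 0 for all β ∈ I. -/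
/-- The planar cross product of `n - a • t` with its derivative is `1 - a' + a ^ 2`. -/
theorem hasDerivWithinAt_normal_sub_smul_tangent {A : ℝ → ℝ} {a' x : ℝ} {s : Set ℝ}
    (hA : HasDerivWithinAt A a' s x) :
    ∃ qd : ℝ × ℝ,
      HasDerivWithinAt
        (fun β => (Real.cos β + A β * Real.sin β, Real.sin β - A β * Real.cos β)) qd s x ∧
      (Real.cos x + A x * Real.sin x) * qd.2 - (Real.sin x - A x * Real.cos x) * qd.1 =
        1 - a' + A x ^ 2 := by
  have hcos := (Real.hasDerivAt_cos x).hasDerivWithinAt (s := s)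
  have hsin := (Real.hasDerivAt_sin x).hasDerivWithinAt (s := s)
  refine ⟨_, (hcos.add (hA.mul hsin)).prodMk (hsin.sub (hA.mul hcos)), ?_⟩
  linear_combination (1 - a' + A x ^ 2) * Real.sin_sq_add_cos_sq x

/-- The coefficient `u (1 / w + m / c) / (1 - m ^ 2)` has a nonpositive derivative when `u`, `m`
are decreasing and `w`, `c` are increasing to first order. -/
theorem exists_hasDerivWithinAt_coeff_nonpos {u w c m : ℝ → ℝ} {u' w' c' m' x : ℝ} {s : Set ℝ}
    (hu : HasDerivWithinAt u u' s x) (hw : HasDerivWithinAt w w' s x)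
    (hc : HasDerivWithinAt c c' s x) (hm : HasDerivWithinAt m m' s x)
    (hu0 : 0 < u x) (hw0 : 0 < w x) (hc0 : 0 < c x) (hm0 : 0 < m x) (hm1 : m x < 1)
    (hu' : u' ≤ 0) (hw' : 0 ≤ w') (hc' : 0 ≤ c') (hm' : m' ≤ 0) :
    ∃ a' ≤ 0, HasDerivWithinAt (fun β => u β * (1 / w β + m β / c β) / (1 - m β ^ 2)) a' s x := by
  have hD : 0 < 1 - m x ^ 2 := by nlinarith
  have hS := ((hasDerivWithinAt_const x s (1 : ℝ)).div hw hw0.ne').add (hm.div hc hc0.ne')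
  have hden := (hm.pow 2).const_sub 1
  refine ⟨_, ?_, (hu.mul hS).div hden hD.ne'⟩
  have hS0 : 0 ≤ 1 / w x + m x / c x := by positivity
  have hS' : (0 * w x - 1 * w') / w x ^ 2 + (m' * c x - m x * c') / c x ^ 2 ≤ 0 := by
    refine add_nonpos (div_nonpos_of_nonpos_of_nonneg ?_ (sq_nonneg _))
      (div_nonpos_of_nonpos_of_nonneg ?_ (sq_nonneg _))
    · linarith
    · nlinarith [mul_nonneg hm0.le hc', mul_nonpos_of_nonpos_of_nonneg hm' hc0.le]
  have hnum' := add_nonpos (mul_nonpos_of_nonpos_of_nonneg hu' hS0)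
    (mul_nonpos_of_nonneg_of_nonpos hu0.le hS')
  have hden' : 0 ≤ -(((2 : ℕ) : ℝ) * m x ^ (2 - 1) * m') := by
    norm_num
    exact mul_nonpos_of_nonneg_of_nonpos (by positivity) hm'
  exact div_nonpos_of_nonpos_of_nonneg
    (sub_nonpos.2 ((mul_nonpos_of_nonpos_of_nonneg hnum' hD.le).trans
      (mul_nonneg (mul_nonneg hu0.le hS0) hden'))) (sq_nonneg _)

/-- Strict convexity of the shock polar: with `A = v^t(1/v_u^n + M/c)/(1−M²)`
and `q(β) = n(β) − A(β)·t(β)` (where `n = (cos β, sin β)`, `t = (−sin β, cos β)`), under the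
stated monotonicity assumptions `A` is differentiable with `A' ≤ 0` and the planar cross
product satisfies `q × q' = 1 − A' + A² ≥ 1 + A² > 0`. -/
theorem stmt_2 (I : Set ℝ) (hI : Convex ℝ I)
    (vt vun c M vt' vun' c' M' : ℝ → ℝ)
    (hvtD : ∀ β ∈ I, HasDerivWithinAt vt (vt' β) I β)
    (hvunD : ∀ β ∈ I, HasDerivWithinAt vun (vun' β) I β)
    (hcD : ∀ β ∈ I, HasDerivWithinAt c (c' β) I β)
    (hMD : ∀ β ∈ I, HasDerivWithinAt M (M' β) I β)
    (hcpos : ∀ β ∈ I, 0 < c β) (hcmono : ∀ β ∈ I, 0 ≤ c' β)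
    (hvunpos : ∀ β ∈ I, 0 < vun β) (hvunmono : ∀ β ∈ I, 0 ≤ vun' β)
    (hvtpos : ∀ β ∈ I, 0 < vt β) (hvtmono : ∀ β ∈ I, vt' β ≤ 0)
    (hMpos : ∀ β ∈ I, 0 < M β) (hMlt : ∀ β ∈ I, M β < 1) (hMmono : ∀ β ∈ I, M' β ≤ 0)
    (A : ℝ → ℝ)
    (hA : ∀ β, A β = vt β * (1 / vun β + M β / c β) / (1 - M β ^ 2))
    (q : ℝ → ℝ × ℝ)
    (hq : ∀ β, q β = (Real.cos β + A β * Real.sin β, Real.sin β - A β * Real.cos β)) :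
    ∃ A' : ℝ → ℝ, ∀ β ∈ I,
      HasDerivWithinAt A (A' β) I β ∧ A' β ≤ 0 ∧
      ∃ qd : ℝ × ℝ, HasDerivWithinAt q qd I β ∧
        (q β).1 * qd.2 - (q β).2 * qd.1 = 1 - A' β + A β ^ 2 ∧
        1 + A β ^ 2 ≤ 1 - A' β + A β ^ 2 ∧
        0 < 1 - A' β + A β ^ 2 := by
  obtain rfl : A = fun β => vt β * (1 / vun β + M β / c β) / (1 - M β ^ 2) := funext hA
  obtain rfl := funext hq
  have key := fun β (hβ : β ∈ I) => exists_hasDerivWithinAt_coeff_nonpos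
    (hvtD β hβ) (hvunD β hβ) (hcD β hβ) (hMD β hβ) (hvtpos β hβ) (hvunpos β hβ) (hcpos β hβ)
    (hMpos β hβ) (hMlt β hβ) (hvtmono β hβ) (hvunmono β hβ) (hcmono β hβ) (hMmono β hβ)
  choose! A' hA' hAD using key
  refine ⟨A', fun β hβ => ⟨hAD β hβ, hA' β hβ, ?_⟩⟩
  obtain ⟨qd, hqd, hcross⟩ := hasDerivWithinAt_normal_sub_smul_tangent (hAD β hβ)
  refine ⟨qd, hqd, hcross, by linarith [hA' β hβ], ?_⟩
  have := hA' β hβ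
  have : 0 < 1 - A' β := by linarith
  positivity
end

section
/- Let c > 0, v_u^n > 0, v_d^n > 0 and v^t ∈ ℝ. Define G := (1 − (v_d^n/c)²)·v_d^n − (v^t)²·(1/v_u^n + v_d^n/c²) and M_d² := ((v_d^n)² + (v^t)²)/c². Then G = v_d^n·(1 − M_d²) − (v^t)²/v_u^n = v_d^n·((1 − M_d²) − (v^t)²/(v_d^n·v_u^n)). In particular, if M_d ≥ 1 and v^t ≠ 0, then G < 0. -/
/-- With `G = (1 − (v_d^n/c)²)v_d^n − (v^t)²(1/v_u^n + v_d^n/c²)` and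
`M_d² = ((v_d^n)² + (v^t)²)/c²`, one has the two algebraic identities
`G = v_d^n(1 − M_d²) − (v^t)²/v_u^n = v_d^n((1 − M_d²) − (v^t)²/(v_d^n v_u^n))`; in
particular a supersonic shock (`M_d ≥ 1`, `v^t ≠ 0`) is weak-type (`G < 0`). -/
theorem stmt_3 (c vun vdn vt G Md2 : ℝ)
    (hc : 0 < c) (hvun : 0 < vun) (hvdn : 0 < vdn)
    (hG : G = (1 - (vdn / c) ^ 2) * vdn - vt ^ 2 * (1 / vun + vdn / c ^ 2))
    (hMd2 : Md2 = (vdn ^ 2 + vt ^ 2) / c ^ 2) :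
    G = vdn * (1 - Md2) - vt ^ 2 / vun ∧
    G = vdn * ((1 - Md2) - vt ^ 2 / (vdn * vun)) ∧
    (1 ≤ Md2 → vt ≠ 0 → G < 0) := by
  have h : G = vdn * (1 - Md2) - vt ^ 2 / vun := by
    rw [hG, hMd2]
    field_simp
    ring
  refine ⟨h, ?_, fun hM hvt => ?_⟩
  · rw [h]
    field_simp
  · have hpos : 0 < vt ^ 2 / vun := by positivity
    have hnonpos : vdn * (1 - Md2) ≤ 0 :=
      mul_nonpos_of_nonneg_of_nonpos hvdn.le (by linarith)
    linarith
end

section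
/- Let c > 0 and a, k > 0 with a² + k² < c². Let Ω := {(x,y) ∈ ℝ² : −a < x < 0, 0 < y < −(k/a)x}, the open triangle with vertices O = (0,0), P_A = (−a,0) and P_B = (−a,k); let A be the open segment from O to P_A (on the x-axis), B the open segment from O to P_B, and S the open segment from P_A to P_B (on the line x = −a). Let α, β, κ : [0,k] → ℝ be continuous with α > 0 and κ < 0 everywhere. Suppose u ∈ C²(Ω) ∩ C¹(cl Ω) satisfies: (c² − x²)u_xx − 2xy·u_xy + (c² − y²)u_yy = 0 in Ω; u_y = 0 on A; k·u_x + a·u_y = 0 on B; and α(y)u_x(−a,y) + β(y)u_y(−a,y) + κ(y)u(−a,y) = 0 for all y ∈ (0,k). If u(P_B) = 0, then u ≡ 0 on cl Ω. Consequently, the real vector space of all u ∈ C²(Ω) ∩ C¹(cl Ω) satisfying these conditions has dimension at most 1. -/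
open Set Filter Topology

/-- Second-order necessary condition for a local maximum of a function of one variable. -/
theorem secondDeriv_nonpos_of_isLocalMax {g g' : ℝ → ℝ} {g'' x : ℝ}
    (hg : ∀ᶠ t in 𝓝 x, HasDerivAt g (g' t) t) (hg' : HasDerivAt g' g'' x)
    (hmax : IsLocalMax g x) : g'' ≤ 0 := by
  by_contra! hpos
  have hderiv : deriv g =ᶠ[𝓝 x] g' := hg.mono fun t ht => ht.deriv
  have hderiv2 : deriv (deriv g) x = g'' := by rw [hderiv.deriv_eq, hg'.deriv]
  have hmin : IsLocalMin g x :=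
    isLocalMin_of_deriv_deriv_pos (by rwa [hderiv2]) hmax.deriv_eq_zero
      hg.self_of_nhds.continuousAt
  have hconst : g =ᶠ[𝓝 x] fun _ => g x := by
    filter_upwards [hmax, hmin] with t h1 h2 using le_antisymm h1 h2
  have hzero : deriv (deriv g) x = 0 := by
    rw [hconst.deriv.deriv_eq]
    simp
  linarith

/-- Second-order necessary condition for an interior local maximum of a function on the plane. -/
theorem hessian_nonpos_of_isLocalMax {v vx vy : ℝ × ℝ → ℝ} {vxx vxy vyy : ℝ} {p : ℝ × ℝ}
    (hv : ∀ᶠ q in 𝓝 p, HasFDerivAt v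
      (vx q • ContinuousLinearMap.fst ℝ ℝ ℝ + vy q • ContinuousLinearMap.snd ℝ ℝ ℝ) q)
    (hvx : HasFDerivAt vx
      (vxx • ContinuousLinearMap.fst ℝ ℝ ℝ + vxy • ContinuousLinearMap.snd ℝ ℝ ℝ) p)
    (hvy : HasFDerivAt vy
      (vxy • ContinuousLinearMap.fst ℝ ℝ ℝ + vyy • ContinuousLinearMap.snd ℝ ℝ ℝ) p)
    (hmax : IsLocalMax v p) (h : ℝ × ℝ) :
    vxx * h.1 ^ 2 + 2 * vxy * (h.1 * h.2) + vyy * h.2 ^ 2 ≤ 0 := by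
  have hline : ∀ t : ℝ, HasDerivAt (fun t : ℝ => p + t • h) h t := fun t => by
    simpa using ((hasDerivAt_id t).smul_const h).const_add p
  have htend : Tendsto (fun t : ℝ => p + t • h) (𝓝 0) (𝓝 p) := by
    simpa [ContinuousAt] using (hline 0).continuousAt
  have hp : p + (0 : ℝ) • h = p := by simp
  refine secondDeriv_nonpos_of_isLocalMax (x := 0) (g := fun t => v (p + t • h))
    (g' := fun t => vx (p + t • h) * h.1 + vy (p + t • h) * h.2) ?_ ?_ ?_
  · filter_upwards [htend.eventually hv] with t ht
    exact (ht.comp_hasDerivAt t (hline t)).congr_deriv (by simp)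
  · have h1 := HasFDerivAt.comp_hasDerivAt (0 : ℝ) (hp.symm ▸ hvx) (hline 0)
    have h2 := HasFDerivAt.comp_hasDerivAt (0 : ℝ) (hp.symm ▸ hvy) (hline 0)
    exact ((h1.mul_const h.1).add (h2.mul_const h.2)).congr_deriv (by simp; ring)
  · filter_upwards [htend.eventually hmax] with t ht
    simpa using ht

/-- A strict subsolution of the elliptic operator `(c² - x²)∂xx - 2xy∂xy + (c² - y²)∂yy` has no
local maximum in the punctured disc of radius `c`. -/
theorem not_isLocalMax_of_strict_subsolution {v vx vy : ℝ × ℝ → ℝ} {c vxx vxy vyy : ℝ}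
    {p : ℝ × ℝ}
    (hv : ∀ᶠ q in 𝓝 p, HasFDerivAt v
      (vx q • ContinuousLinearMap.fst ℝ ℝ ℝ + vy q • ContinuousLinearMap.snd ℝ ℝ ℝ) q)
    (hvx : HasFDerivAt vx
      (vxx • ContinuousLinearMap.fst ℝ ℝ ℝ + vxy • ContinuousLinearMap.snd ℝ ℝ ℝ) p)
    (hvy : HasFDerivAt vy
      (vxy • ContinuousLinearMap.fst ℝ ℝ ℝ + vyy • ContinuousLinearMap.snd ℝ ℝ ℝ) p)
    (h0 : 0 < p.1 ^ 2 + p.2 ^ 2) (hc : p.1 ^ 2 + p.2 ^ 2 ≤ c ^ 2)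
    (hL : 0 < (c ^ 2 - p.1 ^ 2) * vxx - 2 * p.1 * p.2 * vxy + (c ^ 2 - p.2 ^ 2) * vyy) :
    ¬IsLocalMax v p := by
  intro hmax
  have e1 := hessian_nonpos_of_isLocalMax hv hvx hvy hmax p
  have e2 := hessian_nonpos_of_isLocalMax hv hvx hvy hmax (-p.2, p.1)
  have f1 := mul_nonneg (sub_nonneg.2 hc) (neg_nonneg.2 e1)
  have f2 := mul_nonneg (sq_nonneg c) (neg_nonneg.2 e2)
  have f3 := mul_pos h0 hL
  simp only at f2
  nlinarith only [f1, f2, f3]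

/-- At a local maximum the gradient is nonpositive towards every point of a convex domain. -/
theorem IsMaxOn.hasFDerivWithinAt_sub_nonpos {T : Set (ℝ × ℝ)} (hT : Convex ℝ T)
    {v : ℝ × ℝ → ℝ} {vx vy : ℝ} {p q : ℝ × ℝ} (hmax : IsMaxOn v T p)
    (hv : HasFDerivWithinAt v
      (vx • ContinuousLinearMap.fst ℝ ℝ ℝ + vy • ContinuousLinearMap.snd ℝ ℝ ℝ) T p)
    (hp : p ∈ T) (hq : q ∈ T) : vx * (q.1 - p.1) + vy * (q.2 - p.2) ≤ 0 := by
  simpa using hmax.localize.hasFDerivWithinAt_nonpos hv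
    (sub_mem_posTangentConeAt_of_segment_subset (hT.segment_subset hp hq))

/-- A function vanishing on an open interval and continuous on the closed one vanishes there. -/
theorem ContinuousOn.eq_zero_of_Ioo {f : ℝ → ℝ} {l r : ℝ} (hlr : l < r)
    (hf : ContinuousOn f (Icc l r)) (h0 : ∀ x ∈ Ioo l r, f x = 0) : ∀ x ∈ Icc l r, f x = 0 :=
  Set.EqOn.of_subset_closure (g := fun _ => 0) h0 hf continuousOn_const Ioo_subset_Icc_self
    (closure_Ioo hlr.ne).ge

/-- The open triangle with vertices `(0, 0)`, `(-a, 0)` and `(-a, k)`. -/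
def openTriangle (a k : ℝ) : Set (ℝ × ℝ) :=
  {p | -a < p.1 ∧ p.1 < 0 ∧ 0 < p.2 ∧ p.2 < -(k / a) * p.1}

theorem isOpen_openTriangle (a k : ℝ) : IsOpen (openTriangle a k) := by
  simp only [openTriangle, ofPred_and]
  refine (isOpen_lt ?_ ?_).inter ((isOpen_lt ?_ ?_).inter ((isOpen_lt ?_ ?_).inter
    (isOpen_lt ?_ ?_))) <;> fun_prop

theorem convex_openTriangle (a k : ℝ) : Convex ℝ (openTriangle a k) := by
  rintro ⟨x, y⟩ ⟨h1, h2, h3, h4⟩ ⟨x', y'⟩ ⟨h1', h2', h3', h4'⟩ s t hs ht hst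
  simp only [openTriangle, mem_ofPred_eq, Prod.smul_mk, Prod.mk_add_mk, smul_eq_mul] at *
  obtain rfl : t = 1 - s := by linarith
  rcases hs.eq_or_lt with rfl | hs
  · simp_all
  · refine ⟨?_, ?_, ?_, ?_⟩ <;> nlinarith

theorem closure_openTriangle {a k : ℝ} (ha : 0 < a) (hk : 0 < k) :
    closure (openTriangle a k) =
      {p | -a ≤ p.1 ∧ p.1 ≤ 0 ∧ 0 ≤ p.2 ∧ p.2 ≤ -(k / a) * p.1} := by
  apply Subset.antisymm
  · refine closure_minimal (fun p hp => ⟨hp.1.le, hp.2.1.le, hp.2.2.1.le, hp.2.2.2.le⟩) ?_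
    simp only [ofPred_and]
    refine (isClosed_le ?_ ?_).inter ((isClosed_le ?_ ?_).inter ((isClosed_le ?_ ?_).inter
      (isClosed_le ?_ ?_))) <;> fun_prop
  · rintro ⟨x, y⟩ ⟨h1, h2, h3, h4⟩
    simp only at h1 h2 h3 h4
    refine closure_mono ?_ (segment_subset_closure_openSegment
      (left_mem_segment ℝ (x, y) (-a / 2, k / 4)))
    rintro _ ⟨s, t, hs, ht, hst, rfl⟩
    have hka : 0 < k / a := div_pos hk ha
    have hkaa : k / a * a = k := div_mul_cancel₀ k ha.ne'
    obtain rfl : s = 1 - t := by linarith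
    simp only [openTriangle, mem_ofPred_eq, Prod.smul_mk, Prod.mk_add_mk, smul_eq_mul]
    refine ⟨?_, ?_, ?_, ?_⟩ <;> nlinarith [mul_pos ht hk, mul_pos ht ha]

/-- A gradient `(V, W)` pointing away from the triangle at the point of abscissa `x` of its
hypotenuse has a nonnegative component along the outer normal `(k, a)`. -/
theorem conormal_nonneg {a k x V W : ℝ} (ha : 0 < a) (hk : 0 < k) (hx : -a < x) (hx' : x < 0)
    (h1 : V * (0 - x) + W * (0 - -(k / a) * x) ≤ 0)
    (h2 : V * (-a - x) + W * (k - -(k / a) * x) ≤ 0)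
    (h3 : V * (x - x) + W * (0 - -(k / a) * x) ≤ 0) : 0 ≤ k * V + a * W := by
  obtain ⟨r, hr, rfl⟩ : ∃ r, 0 < r ∧ k = r * a :=
    ⟨k / a, div_pos hk ha, (div_mul_cancel₀ k ha.ne').symm⟩
  rw [mul_div_cancel_right₀ r ha.ne'] at h1 h2 h3
  have f1 : V - r * W ≤ 0 := le_of_mul_le_mul_right (a := -x) (by linarith) (by linarith)
  have f2 : 0 ≤ V - r * W := le_of_mul_le_mul_right (a := a + x) (by linarith) (by linarith)
  have f3 : 0 ≤ W :=
    le_of_mul_le_mul_right (a := r * -x) (by linarith) (mul_pos hr (neg_pos.2 hx'))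
  obtain rfl : V = r * W := by linarith
  positivity

/-- Classical solutions of the linearized transonic regular reflection problem. -/
def IsReflectionSolution (c a k : ℝ) (α β κ : ℝ → ℝ) (u : ℝ × ℝ → ℝ) : Prop :=
  ∃ ux uy uxx uxy uyy : ℝ × ℝ → ℝ,
    (∀ p ∈ closure (openTriangle a k), HasFDerivWithinAt u
        (ux p • ContinuousLinearMap.fst ℝ ℝ ℝ + uy p • ContinuousLinearMap.snd ℝ ℝ ℝ)
        (closure (openTriangle a k)) p) ∧
    ContinuousOn ux (closure (openTriangle a k)) ∧
    ContinuousOn uy (closure (openTriangle a k)) ∧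
    (∀ p ∈ openTriangle a k, HasFDerivAt ux
        (uxx p • ContinuousLinearMap.fst ℝ ℝ ℝ + uxy p • ContinuousLinearMap.snd ℝ ℝ ℝ) p) ∧
    (∀ p ∈ openTriangle a k, HasFDerivAt uy
        (uxy p • ContinuousLinearMap.fst ℝ ℝ ℝ + uyy p • ContinuousLinearMap.snd ℝ ℝ ℝ) p) ∧
    ContinuousOn uxx (openTriangle a k) ∧ ContinuousOn uxy (openTriangle a k) ∧
    ContinuousOn uyy (openTriangle a k) ∧
    (∀ p ∈ openTriangle a k, (c ^ 2 - p.1 ^ 2) * uxx p - 2 * p.1 * p.2 * uxy p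
        + (c ^ 2 - p.2 ^ 2) * uyy p = 0) ∧
    (∀ p ∈ {p : ℝ × ℝ | -a < p.1 ∧ p.1 < 0 ∧ p.2 = 0}, uy p = 0) ∧
    (∀ p ∈ {p : ℝ × ℝ | -a < p.1 ∧ p.1 < 0 ∧ p.2 = -(k / a) * p.1}, k * ux p + a * uy p = 0) ∧
    (∀ y ∈ Set.Ioo 0 k, α y * ux (-a, y) + β y * uy (-a, y) + κ y * u (-a, y) = 0)

theorem IsReflectionSolution.linearCombination {c a k : ℝ} {α β κ : ℝ → ℝ} {u v : ℝ × ℝ → ℝ}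
    (hu : IsReflectionSolution c a k α β κ u) (hv : IsReflectionSolution c a k α β κ v)
    (s t : ℝ) : IsReflectionSolution c a k α β κ (fun p => s * u p + t * v p) := by
  obtain ⟨ux, uy, uxx, uxy, uyy, u1, u2, u3, u4, u5, u6, u7, u8, u9, u10, u11, u12⟩ := hu
  obtain ⟨vx, vy, vxx, vxy, vyy, v1, v2, v3, v4, v5, v6, v7, v8, v9, v10, v11, v12⟩ := hv
  refine ⟨fun p => s * ux p + t * vx p, fun p => s * uy p + t * vy p,
    fun p => s * uxx p + t * vxx p, fun p => s * uxy p + t * vxy p,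
    fun p => s * uyy p + t * vyy p, fun p hp => ?_, by fun_prop, by fun_prop, fun p hp => ?_,
    fun p hp => ?_, by fun_prop, by fun_prop, by fun_prop, fun p hp => ?_, fun p hp => ?_,
    fun p hp => ?_, fun y hy => ?_⟩
  · exact (((u1 p hp).const_mul s).add ((v1 p hp).const_mul t)).congr_fderiv (by module)
  · exact (((u4 p hp).const_mul s).add ((v4 p hp).const_mul t)).congr_fderiv (by module)
  · exact (((u5 p hp).const_mul s).add ((v5 p hp).const_mul t)).congr_fderiv (by module)
  · linear_combination s * u9 p hp + t * v9 p hp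
  · linear_combination s * u10 p hp + t * v10 p hp
  · linear_combination s * u11 p hp + t * v11 p hp
  · linear_combination s * u12 y hy + t * v12 y hy

set_option maxHeartbeats 400000 in
/-- Maximum principle: a solution vanishing at the reflection point is nonpositive. -/
theorem IsReflectionSolution.nonpos {c a k : ℝ} (ha : 0 < a) (hk : 0 < k)
    (hsub : a ^ 2 + k ^ 2 < c ^ 2) {α β κ : ℝ → ℝ}
    (hαc : ContinuousOn α (Icc 0 k)) (hβc : ContinuousOn β (Icc 0 k))
    (hκc : ContinuousOn κ (Icc 0 k)) (hαpos : ∀ y ∈ Icc 0 k, 0 < α y)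
    (hκneg : ∀ y ∈ Icc 0 k, κ y < 0) {u : ℝ × ℝ → ℝ}
    (hu : IsReflectionSolution c a k α β κ u) (hP : u (-a, k) = 0) :
    ∀ p ∈ closure (openTriangle a k), u p ≤ 0 := by
  obtain ⟨ux, uy, uxx, uxy, uyy, hgrad, huxc, huyc, huxx, huyy, -, -, -, hL, hA, hB, hS⟩ := hu
  have hconv := (convex_openTriangle a k).closure
  have hopen := isOpen_openTriangle a k
  have hsubset : openTriangle a k ⊆ closure (openTriangle a k) := subset_closure
  have hmem := Set.ext_iff.1 (closure_openTriangle ha hk)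
  simp only [openTriangle, mem_ofPred_eq, Prod.forall] at hmem
  change ∀ x y, (x, y) ∈ closure (openTriangle a k) ↔ _ at hmem
  have hka : 0 < k / a := div_pos hk ha
  have hkaa : k / a * a = k := div_mul_cancel₀ k ha.ne'
  set T := closure (openTriangle a k)
  have huc : ContinuousOn u T := fun p hp => (hgrad p hp).continuousWithinAt
  have hcompact : IsCompact T := by
    refine (isCompact_Icc (a := ((-a, 0) : ℝ × ℝ)) (b := (0, k))).of_isClosed_subset
      isClosed_closure ?_
    rintro ⟨x, y⟩ hp
    obtain ⟨h1, h2, h3, h4⟩ := (hmem x y).1 hp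
    exact ⟨⟨h1, h3⟩, h2, by simp only; nlinarith⟩
  -- the conditions on `A`, `B` and `S` extend to the end points
  have hA' : ∀ x ∈ Icc (-a) 0, uy (x, 0) = 0 := by
    refine ContinuousOn.eq_zero_of_Ioo (by linarith) ?_ fun x hx => hA _ ⟨hx.1, hx.2, rfl⟩
    refine huyc.comp (by fun_prop) fun x hx => (hmem _ _).2 ⟨hx.1, hx.2, le_rfl, ?_⟩
    nlinarith [hx.2]
  have hB' : ∀ x ∈ Icc (-a) 0,
      k * ux (x, -(k / a) * x) + a * uy (x, -(k / a) * x) = 0 := by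
    refine ContinuousOn.eq_zero_of_Ioo (by linarith) ?_ fun x hx => hB _ ⟨hx.1, hx.2, rfl⟩
    have hmaps : MapsTo (fun x : ℝ => (x, -(k / a) * x)) (Icc (-a) 0) T := fun x hx =>
      (hmem _ _).2 ⟨hx.1, hx.2, by nlinarith [hx.2], le_rfl⟩
    exact (continuousOn_const.mul (huxc.comp (by fun_prop) hmaps)).add
      (continuousOn_const.mul (huyc.comp (by fun_prop) hmaps))
  have hS' : ∀ y ∈ Icc 0 k,
      α y * ux (-a, y) + β y * uy (-a, y) + κ y * u (-a, y) = 0 := by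
    refine ContinuousOn.eq_zero_of_Ioo hk ?_ hS
    have hmaps : MapsTo (fun y : ℝ => (-a, y)) (Icc 0 k) T := fun y hy =>
      (hmem _ _).2 ⟨le_rfl, by linarith, hy.1, by linarith [hy.2]⟩
    exact ((hαc.mul (huxc.comp (by fun_prop) hmaps)).add
      (hβc.mul (huyc.comp (by fun_prop) hmaps))).add (hκc.mul (huc.comp (by fun_prop) hmaps))
  -- a convex quadratic, increasing into the triangle along both walls
  obtain ⟨b, hb, hbk⟩ : ∃ b, 0 < b ∧ k * b = 2 * a ^ 2 :=
    ⟨2 * a ^ 2 / k, by positivity, by field_simp⟩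
  set φ : ℝ × ℝ → ℝ := fun p => ((p.1 - b) ^ 2 + (p.2 + a) ^ 2) / 2 with hφ
  have hφ0 : ∀ p, 0 ≤ φ p := fun p => by positivity
  have hφ' : ∀ p, HasFDerivAt φ ((p.1 - b) • ContinuousLinearMap.fst ℝ ℝ ℝ +
      (p.2 + a) • ContinuousLinearMap.snd ℝ ℝ ℝ) p := fun p => by
    have h := ((((hasFDerivAt_fst (𝕜 := ℝ) (p := p)).sub_const b).pow 2).add
      (((hasFDerivAt_snd (𝕜 := ℝ) (p := p)).add_const a).pow 2)).mul_const (1 / 2 : ℝ)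
    refine (h.congr_of_eventuallyEq (f₁ := φ) (.of_forall fun q => ?_)).congr_fderiv ?_
    · simp [hφ]
      ring
    · ext <;> simp
      ring
  obtain ⟨Φ, hΦ⟩ := hcompact.bddAbove_image (f := φ) (by fun_prop)
  obtain ⟨K, hK⟩ := (isCompact_Icc (a := (0 : ℝ)) (b := k)).bddAbove_image
    (f := fun y => (α y * (a + b) + |β y| * (y + a)) / (-κ y))
    (ContinuousOn.div (by fun_prop) (by fun_prop) fun y hy => by linarith [hκneg y hy])
  intro p₀ hp₀
  by_contra! hm
  set m := u p₀
  obtain ⟨ε, hε, hεΦ, hεK⟩ : ∃ ε, 0 < ε ∧ ε * Φ < m / 2 ∧ ε * K < m / 2 := by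
    have h1 : Tendsto (fun ε : ℝ => ε * Φ) (𝓝[>] 0) (𝓝 0) := by
      simpa using ((continuous_mul_const Φ).tendsto 0).mono_left nhdsWithin_le_nhds
    have h2 : Tendsto (fun ε : ℝ => ε * K) (𝓝[>] 0) (𝓝 0) := by
      simpa using ((continuous_mul_const K).tendsto 0).mono_left nhdsWithin_le_nhds
    exact (eventually_mem_nhdsWithin.and ((h1.eventually_lt_const (half_pos hm)).and
      (h2.eventually_lt_const (half_pos hm)))).exists
  obtain ⟨⟨x, y⟩, hpT, hmax⟩ := hcompact.exists_isMaxOn ⟨p₀, hp₀⟩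
    (f := fun p => u p + ε * φ p) (by fun_prop)
  have hupos : m / 2 < u (x, y) := by
    have h1 : u p₀ + ε * φ p₀ ≤ u (x, y) + ε * φ (x, y) := hmax hp₀
    have h2 : φ (x, y) ≤ Φ := hΦ (mem_image_of_mem φ hpT)
    nlinarith [hφ0 p₀, hφ0 (x, y)]
  have hv : ∀ p ∈ T, HasFDerivWithinAt (fun p => u p + ε * φ p)
      ((ux p + ε * (p.1 - b)) • ContinuousLinearMap.fst ℝ ℝ ℝ +
        (uy p + ε * (p.2 + a)) • ContinuousLinearMap.snd ℝ ℝ ℝ) T p := fun p hp => by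
    exact ((hgrad p hp).add ((hφ' p).hasFDerivWithinAt.const_mul ε)).congr_fderiv (by module)
  have hdir : ∀ x' y', (x', y') ∈ T →
      (ux (x, y) + ε * (x - b)) * (x' - x) + (uy (x, y) + ε * (y + a)) * (y' - y) ≤ 0 :=
    fun x' y' hq => hmax.hasFDerivWithinAt_sub_nonpos hconv (hv _ hpT) hpT hq
  have hOT : ((0 : ℝ), (0 : ℝ)) ∈ T := (hmem _ _).2 ⟨by linarith, le_rfl, le_rfl, by simp⟩
  have hPAT : (-a, (0 : ℝ)) ∈ T := (hmem _ _).2 ⟨le_rfl, by linarith, le_rfl, by linarith⟩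
  have hPBT : (-a, k) ∈ T := (hmem _ _).2 ⟨le_rfl, by linarith, hk.le, by linarith⟩
  obtain ⟨h1, h2, h3, h4⟩ := (hmem x y).1 hpT
  rcases h1.eq_or_lt with rfl | h1
  · -- the reflected shock
    have hyk : y ≤ k := by linarith
    have hyk : y < k := hyk.lt_of_ne fun h => by
      subst h
      linarith
    have hyI : y ∈ Icc 0 k := ⟨h3, hyk.le⟩
    have hx : ux (-a, y) + ε * (-a - b) ≤ 0 := by
      rcases h3.eq_or_lt with rfl | h3
      · have := hdir _ _ hOT
        nlinarith
      · have hq := hdir (-(a / k) * y) y ((hmem _ _).2 ⟨?_, ?_, h3.le, ?_⟩)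
        · have : 0 < -(a / k) * y - -a := by
            have : a / k * y < a / k * k := mul_lt_mul_of_pos_left hyk (div_pos ha hk)
            rw [div_mul_cancel₀ a hk.ne'] at this
            linarith
          nlinarith
        · field_simp
          linarith
        · have := div_pos ha hk
          nlinarith
        · field_simp
          linarith
    have hy : uy (-a, y) ≤ 0 ∧ -(ε * (y + a)) ≤ uy (-a, y) := by
      rcases h3.eq_or_lt with rfl | h3
      · rw [hA' (-a) ⟨le_rfl, by linarith⟩]
        exact ⟨le_rfl, by nlinarith⟩
      · have e1 := hdir _ _ hPAT
        have e2 := hdir _ _ hPBT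
        constructor <;> nlinarith [mul_pos hε h3, mul_pos hε ha]
    have hKy : (α y * (a + b) + |β y| * (y + a)) / (-κ y) ≤ K :=
      hK (mem_image_of_mem (fun y => (α y * (a + b) + |β y| * (y + a)) / (-κ y)) hyI)
    rw [div_le_iff₀ (by linarith [hκneg y hyI])] at hKy
    have hβu : β y * uy (-a, y) ≤ |β y| * (ε * (y + a)) := by
      refine (le_abs_self _).trans ?_
      rw [abs_mul]
      exact mul_le_mul_of_nonneg_left (abs_le.2 ⟨hy.2, by nlinarith⟩) (abs_nonneg _)
    have hαu : α y * ux (-a, y) ≤ α y * (ε * (a + b)) :=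
      mul_le_mul_of_nonneg_left (by linarith) (hαpos y hyI).le
    have hκu : κ y * u (-a, y) < κ y * (ε * K) :=
      mul_lt_mul_of_neg_left (by linarith) (hκneg y hyI)
    have := hS' y hyI
    have := mul_le_mul_of_nonneg_left hKy hε.le
    linarith
  rcases h2.eq_or_lt with rfl | h2
  · -- the wall corner
    obtain rfl : y = 0 := by linarith
    have e1 := hA' 0 ⟨by linarith, le_rfl⟩
    have e2 := hB' 0 ⟨by linarith, le_rfl⟩
    rw [mul_zero, e1] at e2
    have e3 : ux (0, 0) = 0 := by
      rcases mul_eq_zero.1 (show k * ux (0, 0) = 0 by linarith) with h | h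
      · exact absurd h hk.ne'
      · exact h
    have e4 := hdir _ _ hPAT
    rw [e1, e3] at e4
    nlinarith [mul_pos hε (mul_pos hb ha)]
  rcases h3.eq_or_lt with rfl | h3
  · -- the wall `A`
    have hpos : 0 < -(k / a) * x := by nlinarith
    have e1 := hdir x (-(k / a) * x) ((hmem _ _).2 ⟨h1.le, h2.le, hpos.le, le_rfl⟩)
    rw [hA' x ⟨h1.le, h2.le⟩] at e1
    nlinarith [mul_pos hε (mul_pos ha hpos)]
  rcases h4.eq_or_lt with rfl | h4
  · -- the wall `B`
    have e0 := hB' x ⟨h1.le, h2.le⟩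
    have e1 := hdir _ _ hOT
    have e2 := hdir _ _ hPBT
    have e3 := hdir x 0 ((hmem _ _).2 ⟨h1.le, h2.le, le_rfl, h3.le⟩)
    have e4 := conormal_nonneg ha hk h1 h2 e1 e2 e3
    linarith [show k * (ux (x, -(k / a) * x) + ε * (x - b)) +
        a * (uy (x, -(k / a) * x) + ε * (-(k / a) * x + a)) = -(ε * a ^ 2) by
      linear_combination e0 - ε * hbk - ε * x * hkaa, mul_pos hε (pow_pos ha 2)]
  · -- the interior
    have hpΩ : (x, y) ∈ openTriangle a k := ⟨h1, h2, h3, h4⟩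
    have hev : ∀ᶠ q in 𝓝 (x, y), q ∈ openTriangle a k := hopen.mem_nhds hpΩ
    have hx2 : x ^ 2 < a ^ 2 := by nlinarith
    have hy2 : y ^ 2 < k ^ 2 := by
      have : y < k := by nlinarith
      nlinarith
    refine not_isLocalMax_of_strict_subsolution (c := c) (v := fun p => u p + ε * φ p)
      (vx := fun p => ux p + ε * (p.1 - b)) (vy := fun p => uy p + ε * (p.2 + a))
      (vxx := uxx (x, y) + ε) (vxy := uxy (x, y)) (vyy := uyy (x, y) + ε) (p := (x, y))
      (hev.mono fun q hq => (hv q (hsubset hq)).hasFDerivAt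
        (mem_of_superset (hopen.mem_nhds hq) hsubset))
      (((huxx _ hpΩ).add ((hasFDerivAt_fst.sub_const b).const_mul ε)).congr_fderiv (by module))
      (((huyy _ hpΩ).add ((hasFDerivAt_snd.add_const a).const_mul ε)).congr_fderiv (by module))
      (add_pos (sq_pos_of_neg h2) (pow_pos h3 2)) ?_ ?_
      (hmax.isLocalMax (mem_of_superset hev hsubset))
    · simp only
      linarith
    · have e0 := hL _ hpΩ
      have e1 : 0 < ε * (2 * c ^ 2 - x ^ 2 - y ^ 2) :=
        mul_pos hε (by linarith [sq_nonneg x, sq_nonneg y])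
      simp only at e0 ⊢
      linarith

theorem IsReflectionSolution.eq_zero {c a k : ℝ} (ha : 0 < a) (hk : 0 < k)
    (hsub : a ^ 2 + k ^ 2 < c ^ 2) {α β κ : ℝ → ℝ}
    (hαc : ContinuousOn α (Icc 0 k)) (hβc : ContinuousOn β (Icc 0 k))
    (hκc : ContinuousOn κ (Icc 0 k)) (hαpos : ∀ y ∈ Icc 0 k, 0 < α y)
    (hκneg : ∀ y ∈ Icc 0 k, κ y < 0) {u : ℝ × ℝ → ℝ}
    (hu : IsReflectionSolution c a k α β κ u) (hP : u (-a, k) = 0) :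
    ∀ p ∈ closure (openTriangle a k), u p = 0 := by
  intro p hp
  have h1 := hu.nonpos ha hk hsub hαc hβc hκc hαpos hκneg hP p hp
  have h2 := (hu.linearCombination hu (-1) 0).nonpos ha hk hsub hαc hβc hκc hαpos hκneg
    (by simp [hP]) p hp
  linarith


/-- Kernel bound for the linearized transonic regular reflection problem:
a solution `u ∈ C²(Ω) ∩ C¹(cl Ω)` of the elliptic equation
`(c² − x²)u_xx − 2xy·u_xy + (c² − y²)u_yy = 0` in the subsonic triangle `Ω`, with slip
conditions `u_y = 0` on `A`, `k·u_x + a·u_y = 0` on `B` and the oblique linearized shock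
condition `α u_x + β u_y + κ u = 0` on `S` (`α > 0`, `κ < 0`), vanishing at the reflection
point `P_B = (−a,k)`, vanishes identically; hence the solution space has dimension ≤ 1. -/
theorem stmt_4 (c a k : ℝ) (hc : 0 < c) (ha : 0 < a) (hk : 0 < k)
    (hsub : a ^ 2 + k ^ 2 < c ^ 2)
    (Ω A B S : Set (ℝ × ℝ))
    (hΩ : Ω = {p : ℝ × ℝ | -a < p.1 ∧ p.1 < 0 ∧ 0 < p.2 ∧ p.2 < -(k / a) * p.1})
    (hA : A = {p : ℝ × ℝ | -a < p.1 ∧ p.1 < 0 ∧ p.2 = 0})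
    (hB : B = {p : ℝ × ℝ | -a < p.1 ∧ p.1 < 0 ∧ p.2 = -(k / a) * p.1})
    (hS : S = {p : ℝ × ℝ | p.1 = -a ∧ 0 < p.2 ∧ p.2 < k})
    (α β κ : ℝ → ℝ)
    (hαc : ContinuousOn α (Set.Icc 0 k)) (hβc : ContinuousOn β (Set.Icc 0 k))
    (hκc : ContinuousOn κ (Set.Icc 0 k))
    (hαpos : ∀ y ∈ Set.Icc 0 k, 0 < α y)
    (hκneg : ∀ y ∈ Set.Icc 0 k, κ y < 0)
    (Sol : (ℝ × ℝ → ℝ) → Prop)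
    (hSol : ∀ u, Sol u ↔
      ∃ ux uy uxx uxy uyy : ℝ × ℝ → ℝ,
        (∀ p ∈ closure Ω, HasFDerivWithinAt u
            (ux p • ContinuousLinearMap.fst ℝ ℝ ℝ + uy p • ContinuousLinearMap.snd ℝ ℝ ℝ)
            (closure Ω) p) ∧
        ContinuousOn ux (closure Ω) ∧ ContinuousOn uy (closure Ω) ∧
        (∀ p ∈ Ω, HasFDerivAt ux
            (uxx p • ContinuousLinearMap.fst ℝ ℝ ℝ + uxy p • ContinuousLinearMap.snd ℝ ℝ ℝ) p) ∧
        (∀ p ∈ Ω, HasFDerivAt uy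
            (uxy p • ContinuousLinearMap.fst ℝ ℝ ℝ + uyy p • ContinuousLinearMap.snd ℝ ℝ ℝ) p) ∧
        ContinuousOn uxx Ω ∧ ContinuousOn uxy Ω ∧ ContinuousOn uyy Ω ∧
        (∀ p ∈ Ω, (c ^ 2 - p.1 ^ 2) * uxx p - 2 * p.1 * p.2 * uxy p
            + (c ^ 2 - p.2 ^ 2) * uyy p = 0) ∧
        (∀ p ∈ A, uy p = 0) ∧
        (∀ p ∈ B, k * ux p + a * uy p = 0) ∧
        (∀ y ∈ Set.Ioo 0 k, α y * ux (-a, y) + β y * uy (-a, y) + κ y * u (-a, y) = 0)) :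
    (∀ u, Sol u → u (-a, k) = 0 → ∀ p ∈ closure Ω, u p = 0) ∧
    (∀ u v, Sol u → Sol v → ∃ s t : ℝ, (s, t) ≠ (0, 0) ∧
      ∀ p ∈ closure Ω, s * u p + t * v p = 0) := by
  obtain rfl : Ω = openTriangle a k := hΩ
  subst hA hB hS
  have key : ∀ u, Sol u → u (-a, k) = 0 → ∀ p ∈ closure (openTriangle a k), u p = 0 :=
    fun u hu => IsReflectionSolution.eq_zero ha hk hsub hαc hβc hκc hαpos hκneg ((hSol u).1 hu)
  refine ⟨key, fun u v hu hv => ?_⟩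
  by_cases hP : u (-a, k) = 0
  · exact ⟨1, 0, by simp, fun p hp => by simp [key u hu hP p hp]⟩
  · refine ⟨v (-a, k), -u (-a, k), by simp [hP], ?_⟩
    refine key (fun p => v (-a, k) * u p + -u (-a, k) * v p) ((hSol _).2 ?_) (by ring)
    exact IsReflectionSolution.linearCombination ((hSol u).1 hu) ((hSol v).1 hv) _ _
end

section
/- Let φ₁ < φ₂ and γ₁, γ₂ ∈ ℝ, and let β ∈ ℝ with β ≠ 0. For δ ∈ ℝ define f_δ : ℝ² → ℝ by f_δ(t,φ) := e^{βt}·sin(βφ − δ); every such f_δ satisfies ∂_tt f_δ + ∂_φφ f_δ = 0 on ℝ². There exists δ ∈ ℝ such that cos(γ_k)·∂_t f_δ(t, φ_k) + sin(γ_k)·∂_φ f_δ(t, φ_k) = 0 for all t ∈ ℝ and both k = 1, 2, if and only if there exists ℓ ∈ ℤ with β = (πℓ − (γ₂ − γ₁))/(φ₂ − φ₁). -/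
/-- The derivative of `s ↦ e^{βs}·c`. -/
theorem deriv_exp_mul_mul_const (β c t : ℝ) :
    deriv (fun s => Real.exp (β * s) * c) t = Real.exp (β * t) * (β * c) := by
  have h := (((hasDerivAt_id t).const_mul β).exp.mul_const c).deriv
  simp only [id_eq] at h
  rw [h]
  ring

/-- The derivative of `ψ ↦ c·sin(βψ − δ)`. -/
theorem deriv_const_mul_sin_sub (β δ c φ : ℝ) :
    deriv (fun ψ => c * Real.sin (β * ψ - δ)) φ = c * β * Real.cos (β * φ - δ) := by
  have h := ((((hasDerivAt_id φ).const_mul β).sub_const δ).sin.const_mul c).deriv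
  simp only [id_eq] at h
  rw [h]
  ring

/-- The derivative of `ψ ↦ c·cos(βψ − δ)`. -/
theorem deriv_const_mul_cos_sub (β δ c φ : ℝ) :
    deriv (fun ψ => c * Real.cos (β * ψ - δ)) φ = -(c * β * Real.sin (β * φ - δ)) := by
  have h := ((((hasDerivAt_id φ).const_mul β).sub_const δ).cos.const_mul c).deriv
  simp only [id_eq] at h
  rw [h]
  ring

/-- The oblique boundary operator annihilates `e^{βt}·sin(βφ − δ)` at `(t, φ)` exactly when
`βφ + γ − δ` is an integer multiple of `π`. -/
theorem oblique_deriv_eq_zero_iff {β : ℝ} (hβ : β ≠ 0) (γ δ t φ : ℝ) :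
    Real.cos γ * deriv (fun s => Real.exp (β * s) * Real.sin (β * φ - δ)) t
        + Real.sin γ * deriv (fun ψ => Real.exp (β * t) * Real.sin (β * ψ - δ)) φ = 0
      ↔ ∃ n : ℤ, (n : ℝ) * Real.pi = β * φ - δ + γ := by
  rw [deriv_exp_mul_mul_const, deriv_const_mul_sin_sub, ← Real.sin_eq_zero_iff]
  have h : Real.cos γ * (Real.exp (β * t) * (β * Real.sin (β * φ - δ)))
      + Real.sin γ * (Real.exp (β * t) * β * Real.cos (β * φ - δ))
      = Real.exp (β * t) * β * Real.sin (β * φ - δ + γ) := by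
    rw [Real.sin_add]
    ring
  rw [h, mul_eq_zero, or_iff_right (mul_ne_zero (Real.exp_ne_zero _) hβ)]

/-- Operator-pencil eigenvalue computation in a corner strip: the functions
`f_δ(t,φ) = e^{βt}·sin(βφ − δ)` are harmonic on the strip, and there is a `δ` for which the
boundary operators `cos γ_k ∂_t + sin γ_k ∂_φ` annihilate `f_δ` on both lines `φ = φ_k`
(`k = 1,2`) if and only if `β = (πℓ − (γ₂ − γ₁))/(φ₂ − φ₁)` for some integer `ℓ`. -/
theorem stmt_5 (φ₁ φ₂ γ₁ γ₂ β : ℝ) (hφ : φ₁ < φ₂) (hβ : β ≠ 0) :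
    (∀ δ t φ : ℝ,
        deriv (fun s => deriv (fun s' => Real.exp (β * s') * Real.sin (β * φ - δ)) s) t
          + deriv (fun ψ => deriv (fun ψ' => Real.exp (β * t) * Real.sin (β * ψ' - δ)) ψ) φ
          = 0) ∧
    ((∃ δ : ℝ, ∀ t : ℝ,
        (Real.cos γ₁ * deriv (fun s => Real.exp (β * s) * Real.sin (β * φ₁ - δ)) t
          + Real.sin γ₁ * deriv (fun ψ => Real.exp (β * t) * Real.sin (β * ψ - δ)) φ₁ = 0) ∧
        (Real.cos γ₂ * deriv (fun s => Real.exp (β * s) * Real.sin (β * φ₂ - δ)) t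
          + Real.sin γ₂ * deriv (fun ψ => Real.exp (β * t) * Real.sin (β * ψ - δ)) φ₂ = 0))
      ↔ ∃ ℓ : ℤ, β = (Real.pi * ℓ - (γ₂ - γ₁)) / (φ₂ - φ₁)) := by
  have hd : φ₂ - φ₁ ≠ 0 := (sub_pos.2 hφ).ne'
  refine ⟨fun δ t φ => ?_, ?_⟩
  · simp only [deriv_exp_mul_mul_const, deriv_const_mul_sin_sub, deriv_const_mul_cos_sub]
    ring
  · simp only [oblique_deriv_eq_zero_iff hβ, forall_const, eq_div_iff hd]
    constructor
    · rintro ⟨δ, ⟨m, hm⟩, n, hn⟩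
      refine ⟨n - m, ?_⟩
      push_cast
      linarith
    · rintro ⟨ℓ, hℓ⟩
      refine ⟨β * φ₁ + γ₁, ⟨0, ?_⟩, ℓ, ?_⟩
      · push_cast
        ring
      · linarith
end

section
/- Let X₋ and Y₋ be real Banach spaces, and let X₊ ⊆ X₋ and Y₊ ⊆ Y₋ be linear subspaces each equipped with a complete norm making the inclusion maps continuous. Let A : X₋ → Y₋ be a continuous linear map with A(X₊) ⊆ Y₊ whose restriction A₊ : X₊ → Y₊ is continuous; write A₋ := A. Assume A₋ and A₊ are Fredholm: ker A₋ and ker A₊ are finite-dimensional, and ran A₋ is closed of finite codimension in Y₋ while ran A₊ is closed of finite codimension in Y₊. Assume moreover that every continuous linear functional on Y₋ that vanishes on both ran A₋ and Y₊ vanishes identically. Set Z := {u ∈ X₋ : A u ∈ Y₊} and suppose d := dim(Z/(Z ∩ X₊)) < ∞. Then ind A₋ − ind A₊ = d, where ind A₋ := dim ker A₋ − codim_{Y₋} ran A₋ and ind A₊ := dim ker A₊ − codim_{Y₊} ran A₊. -/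
/-- The alternating sum of dimensions in an exact sequence
`0 → V₁ → V₂ → V₃ → V₄ → V₅ → 0` of finite-dimensional vector spaces vanishes. -/
theorem finrank_alternating_sum_of_exact {K V₁ V₂ V₃ V₄ V₅ : Type*} [Field K]
    [AddCommGroup V₁] [Module K V₁] [AddCommGroup V₂] [Module K V₂]
    [AddCommGroup V₃] [Module K V₃] [AddCommGroup V₄] [Module K V₄]
    [AddCommGroup V₅] [Module K V₅]
    [FiniteDimensional K V₂] [FiniteDimensional K V₃] [FiniteDimensional K V₄]
    (f : V₁ →ₗ[K] V₂) (g : V₂ →ₗ[K] V₃) (h : V₃ →ₗ[K] V₄) (k : V₄ →ₗ[K] V₅)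
    (hf : Function.Injective f) (hfg : Function.Exact f g) (hgh : Function.Exact g h)
    (hhk : Function.Exact h k) (hk : Function.Surjective k) :
    (Module.finrank K V₁ : ℤ) - Module.finrank K V₂ + Module.finrank K V₃
      - Module.finrank K V₄ + Module.finrank K V₅ = 0 := by
  have h₁ := LinearMap.finrank_range_of_inj hf
  have h₂ := g.finrank_range_add_finrank_ker
  have h₃ := h.finrank_range_add_finrank_ker
  have h₄ := k.finrank_range_add_finrank_ker
  rw [hfg.linearMap_ker_eq] at h₂
  rw [hgh.linearMap_ker_eq] at h₃
  rw [hhk.linearMap_ker_eq, LinearMap.range_eq_top.2 hk, finrank_top] at h₄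
  omega

/-- If no nonzero continuous functional vanishes on both `R` and `S`, where `R` is closed of
finite codimension, then `S` maps onto the quotient by `R`. -/
theorem Submodule.map_mkQ_eq_top_of_forall_dual {E : Type*} [NormedAddCommGroup E]
    [NormedSpace ℝ E] (R S : Submodule ℝ E) (hR : IsClosed (R : Set E))
    [FiniteDimensional ℝ (E ⧸ R)]
    (hann : ∀ f : E →L[ℝ] ℝ, (∀ x ∈ R, f x = 0) → (∀ y ∈ S, f y = 0) → f = 0) :
    S.map R.mkQ = ⊤ := by
  have := hR
  by_contra hne
  obtain ⟨f, hf0, hf⟩ := Submodule.exists_le_ker_of_lt_top _ (lt_top_iff_ne_top.2 hne)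
  have hzero := hann ((LinearMap.toContinuousLinearMap f).comp R.mkQL)
    (fun x hx => by simp [(Submodule.Quotient.mk_eq_zero R).2 hx])
    (fun y hy => hf (Submodule.mem_map_of_mem hy))
  refine hf0 (Submodule.linearMap_qext _ (LinearMap.ext fun x => ?_))
  exact DFunLike.congr_fun hzero x


/-- Fredholm index jump: for a continuous linear operator `A₋ : X₋ → Y₋`
restricting to a continuous operator `A₊ : X₊ → Y₊` between continuously embedded Banach
subspaces (realized here by injective continuous linear embeddings `i, j`), with both
restrictions Fredholm and the annihilator condition on `Y₋`, one has
`ind A₋ − ind A₊ = dim(Z/(Z ∩ X₊))` where `Z = A⁻¹(Y₊)`. -/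
theorem stmt_8
    (Xm Ym Xp Yp : Type*)
    [NormedAddCommGroup Xm] [NormedSpace ℝ Xm] [CompleteSpace Xm]
    [NormedAddCommGroup Ym] [NormedSpace ℝ Ym] [CompleteSpace Ym]
    [NormedAddCommGroup Xp] [NormedSpace ℝ Xp] [CompleteSpace Xp]
    [NormedAddCommGroup Yp] [NormedSpace ℝ Yp] [CompleteSpace Yp]
    (i : Xp →L[ℝ] Xm) (j : Yp →L[ℝ] Ym)
    (hi : Function.Injective i) (hj : Function.Injective j)
    (Am : Xm →L[ℝ] Ym) (Ap : Xp →L[ℝ] Yp)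
    (hcomm : ∀ x : Xp, Am (i x) = j (Ap x))
    (hkerm : FiniteDimensional ℝ (LinearMap.ker (Am : Xm →ₗ[ℝ] Ym)))
    (hkerp : FiniteDimensional ℝ (LinearMap.ker (Ap : Xp →ₗ[ℝ] Yp)))
    (hranm : IsClosed ((LinearMap.range (Am : Xm →ₗ[ℝ] Ym) : Submodule ℝ Ym) : Set Ym))
    (hranp : IsClosed ((LinearMap.range (Ap : Xp →ₗ[ℝ] Yp) : Submodule ℝ Yp) : Set Yp))
    (hcokerm : FiniteDimensional ℝ (Ym ⧸ LinearMap.range (Am : Xm →ₗ[ℝ] Ym)))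
    (hcokerp : FiniteDimensional ℝ (Yp ⧸ LinearMap.range (Ap : Xp →ₗ[ℝ] Yp)))
    (hann : ∀ f : Ym →L[ℝ] ℝ, (∀ x : Xm, f (Am x) = 0) → (∀ y : Yp, f (j y) = 0) → f = 0)
    (Z : Submodule ℝ Xm)
    (hZ : Z = Submodule.comap (Am : Xm →ₗ[ℝ] Ym) (LinearMap.range (j : Yp →ₗ[ℝ] Ym)))
    (hfin : FiniteDimensional ℝ
      (↥Z ⧸ Submodule.comap Z.subtype (LinearMap.range (i : Xp →ₗ[ℝ] Xm)))) :
    ((Module.finrank ℝ (LinearMap.ker (Am : Xm →ₗ[ℝ] Ym)) : ℤ)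
        - Module.finrank ℝ (Ym ⧸ LinearMap.range (Am : Xm →ₗ[ℝ] Ym)))
      - ((Module.finrank ℝ (LinearMap.ker (Ap : Xp →ₗ[ℝ] Yp)) : ℤ)
        - Module.finrank ℝ (Yp ⧸ LinearMap.range (Ap : Xp →ₗ[ℝ] Yp)))
      = Module.finrank ℝ
          (↥Z ⧸ Submodule.comap Z.subtype (LinearMap.range (i : Xp →ₗ[ℝ] Xm))) := by
  have hsurj := Submodule.map_mkQ_eq_top_of_forall_dual
    (LinearMap.range (Am : Xm →ₗ[ℝ] Ym)) (LinearMap.range (j : Yp →ₗ[ℝ] Ym)) hranm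
    (fun f hA hj => hann f (fun x => hA _ ⟨x, rfl⟩) (fun y => hj _ ⟨y, rfl⟩))
  have hZmem : ∀ z, z ∈ Z ↔ ∃ y, j y = Am z := fun z => by subst hZ; rfl
  obtain ⟨B, hB⟩ : ∃ B : Z →ₗ[ℝ] Yp, ∀ z, j (B z) = Am z := by
    let e := LinearEquiv.ofInjective (j : Yp →ₗ[ℝ] Ym) hj
    refine ⟨e.symm.toLinearMap ∘ₗ
      ((Am : Xm →ₗ[ℝ] Ym).restrict (p := Z) (q := LinearMap.range (j : Yp →ₗ[ℝ] Ym))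
        fun z hz => (hZmem z).1 hz), fun z => ?_⟩
    exact congrArg Subtype.val (e.apply_symm_apply ⟨Am z, (hZmem z).1 z.2⟩)
  have hBi : ∀ (z : Z) (x : Xp), i x = z → B z = Ap x := fun z x h =>
    hj (by rw [hB, ← h, hcomm])
  let f : LinearMap.ker (Ap : Xp →ₗ[ℝ] Yp) →ₗ[ℝ] LinearMap.ker (Am : Xm →ₗ[ℝ] Ym) :=
    (i : Xp →ₗ[ℝ] Xm).restrict fun x hx => by
      have hx' : Ap x = 0 := hx
      simp [hcomm, hx']
  let P := Submodule.comap Z.subtype (LinearMap.range (i : Xp →ₗ[ℝ] Xm))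
  have hker : LinearMap.ker (Am : Xm →ₗ[ℝ] Ym) ≤ Z := fun z hz =>
    (hZmem z).2 ⟨0, by rw [map_zero]; exact (show Am z = 0 from hz).symm⟩
  let g : LinearMap.ker (Am : Xm →ₗ[ℝ] Ym) →ₗ[ℝ] Z ⧸ P := P.mkQ ∘ₗ Submodule.inclusion hker
  let h : (Z ⧸ P) →ₗ[ℝ] Yp ⧸ LinearMap.range (Ap : Xp →ₗ[ℝ] Yp) :=
    P.mapQ _ B fun z ⟨x, hx⟩ => ⟨x, (hBi z x hx).symm⟩
  let k : (Yp ⧸ LinearMap.range (Ap : Xp →ₗ[ℝ] Yp)) →ₗ[ℝ]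
      Ym ⧸ LinearMap.range (Am : Xm →ₗ[ℝ] Ym) :=
    Submodule.mapQ _ _ (j : Yp →ₗ[ℝ] Ym) (by rintro _ ⟨x, rfl⟩; exact ⟨i x, hcomm x⟩)
  have hf : Function.Injective f := fun x y hxy =>
    Subtype.ext (hi (congrArg Subtype.val hxy))
  have hfg : Function.Exact f g := by
    intro z
    refine (Submodule.Quotient.mk_eq_zero P).trans ⟨?_, ?_⟩
    · rintro ⟨x, hx⟩
      refine ⟨⟨x, hj ?_⟩, Subtype.ext hx⟩
      have hx' : i x = z := hx
      have hz : Am z = 0 := z.2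
      simp [← hcomm, hx', hz]
    · rintro ⟨x, rfl⟩
      exact ⟨x, rfl⟩
  have hgh : Function.Exact g h := by
    intro q
    obtain ⟨z, rfl⟩ := P.mkQ_surjective q
    refine (Submodule.Quotient.mk_eq_zero _).trans ⟨?_, ?_⟩
    · rintro ⟨x, hx⟩
      have hx' : Ap x = B z := hx
      refine ⟨⟨z - i x, ?_⟩, (Submodule.Quotient.eq P).2 ⟨-x, ?_⟩⟩
      · simp [hcomm, hx', hB]
      · simp
    · rintro ⟨w, hw⟩
      obtain ⟨x, hx⟩ := (Submodule.Quotient.eq P).1 hw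
      have hx' : i x = w - z := hx
      have hw0 : Am w = 0 := w.2
      refine ⟨-x, hj ?_⟩
      simp [← hcomm, hx', hw0, hB]
  have hhk : Function.Exact h k := by
    intro q
    obtain ⟨y, rfl⟩ := Submodule.mkQ_surjective _ q
    refine (Submodule.Quotient.mk_eq_zero _).trans ⟨?_, ?_⟩
    · rintro ⟨x, hx⟩
      have hx' : Am x = j y := hx
      refine ⟨P.mkQ ⟨x, (hZmem x).2 ⟨y, hx'.symm⟩⟩, ?_⟩
      exact congrArg (Submodule.mkQ _) (hj ((hB _).trans hx'))
    · rintro ⟨p, hp⟩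
      obtain ⟨z, rfl⟩ := P.mkQ_surjective p
      obtain ⟨x, hx⟩ := (Submodule.Quotient.eq _).1 hp
      have hx' : Ap x = B z - y := hx
      refine ⟨z - i x, ?_⟩
      simp [hcomm, hx', hB]
  have hk : Function.Surjective k := by
    intro q
    obtain ⟨_, ⟨y, rfl⟩, hy⟩ := hsurj.ge (Submodule.mem_top (x := q))
    exact ⟨Submodule.Quotient.mk y, hy⟩
  have := finrank_alternating_sum_of_exact f g h k hf hfg hgh hhk hk
  linarith
end

section
/- Let X₋ and Y₋ be real Banach spaces, X₊ ⊆ X₋ and Y₊ ⊆ Y₋ linear subspaces each equipped with a complete norm making the inclusions continuous, and A : X₋ → Y₋ a continuous linear map with A(X₊) ⊆ Y₊ whose restriction A₊ : X₊ → Y₊ is continuous; write A₋ := A. Assume A₋ and A₊ are Fredholm (finite-dimensional kernels, closed ranges of finite codimension), and that every continuous linear functional on Y₋ vanishing on both ran A₋ and Y₊ vanishes identically. Set Z := {u ∈ X₋ : A u ∈ Y₊} and suppose dim(Z/(Z ∩ X₊)) < ∞. Then dim(Z/(Z ∩ X₊)) = dim(ker A₋/(ker A₋ ∩ X₊)) +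 (codim_{Y₊} ran A₊ − codim_{Y₋} ran A₋). -/
/-- The alternating sum of the dimensions of an exact sequence `0 → U → V → W → T → 0` vanishes. -/
theorem finrank_add_finrank_of_exact_four {K U V W T : Type*} [Field K]
    [AddCommGroup U] [Module K U] [AddCommGroup V] [Module K V]
    [AddCommGroup W] [Module K W] [AddCommGroup T] [Module K T]
    [FiniteDimensional K V] [FiniteDimensional K W]
    (f : U →ₗ[K] V) (g : V →ₗ[K] W) (h : W →ₗ[K] T)
    (hf : Function.Injective f) (hfg : Function.Exact f g) (hgh : Function.Exact g h)
    (hh : Function.Surjective h) :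
    Module.finrank K V + Module.finrank K T = Module.finrank K U + Module.finrank K W := by
  have hV := g.finrank_range_add_finrank_ker
  have hW := h.finrank_range_add_finrank_ker
  rw [hfg.linearMap_ker_eq, LinearMap.finrank_range_of_inj hf] at hV
  rw [hgh.linearMap_ker_eq, LinearMap.range_eq_top.2 hh, finrank_top] at hW
  omega

/-- For a commuting square `a ∘ i = j ∘ b` with `j` injective and `range a ⊔ range j = ⊤`, the
dimension of `a⁻¹(range j)` modulo `range i` is that of `ker a` modulo `range i` plus the jump of
the codimensions of the ranges. -/
theorem finrank_comap_range_quotient {K X Y X' Y' : Type*} [Field K]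
    [AddCommGroup X] [Module K X] [AddCommGroup Y] [Module K Y]
    [AddCommGroup X'] [Module K X'] [AddCommGroup Y'] [Module K Y']
    (i : X' →ₗ[K] X) (j : Y' →ₗ[K] Y) (hj : Function.Injective j)
    (a : X →ₗ[K] Y) (b : X' →ₗ[K] Y') (hcomm : ∀ x, a (i x) = j (b x))
    (hsup : LinearMap.range a ⊔ LinearMap.range j = ⊤)
    [FiniteDimensional K (Y' ⧸ LinearMap.range b)]
    [FiniteDimensional K (↥((LinearMap.range j).comap a) ⧸
      (LinearMap.range i).comap ((LinearMap.range j).comap a).subtype)] :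
    Module.finrank K (↥((LinearMap.range j).comap a) ⧸
        (LinearMap.range i).comap ((LinearMap.range j).comap a).subtype)
      + Module.finrank K (Y ⧸ LinearMap.range a)
      = Module.finrank K (↥(LinearMap.ker a) ⧸
          (LinearMap.range i).comap (LinearMap.ker a).subtype)
        + Module.finrank K (Y' ⧸ LinearMap.range b) := by
  have hle : LinearMap.ker a ≤ (LinearMap.range j).comap a := LinearMap.ker_le_comap a
  let lift : ↥((LinearMap.range j).comap a) →ₗ[K] Y' :=
    (LinearEquiv.ofInjective j hj).symm.toLinearMap ∘ₗ
      a.restrict (p := (LinearMap.range j).comap a) (q := LinearMap.range j) fun _ hx => hx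
  have j_lift (z : ↥((LinearMap.range j).comap a)) : j (lift z) = a z :=
    congrArg Subtype.val ((LinearEquiv.ofInjective j hj).apply_symm_apply ⟨a z, z.2⟩)
  refine finrank_add_finrank_of_exact_four
    (Submodule.mapQ ((LinearMap.range i).comap (LinearMap.ker a).subtype)
      ((LinearMap.range i).comap ((LinearMap.range j).comap a).subtype)
      (Submodule.inclusion hle) ?_)
    (Submodule.mapQ ((LinearMap.range i).comap ((LinearMap.range j).comap a).subtype)
      (LinearMap.range b) lift ?_)
    (Submodule.mapQ (LinearMap.range b) (LinearMap.range a) j ?_) ?_ ?_ ?_ ?_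
  · rintro _ ⟨x, hx⟩
    exact ⟨x, hx⟩
  · rintro z ⟨x, hx⟩
    exact ⟨x, hj (by rw [j_lift, ← hcomm, hx]; rfl)⟩
  · rintro _ ⟨x, rfl⟩
    exact ⟨i x, hcomm x⟩
  · rw [injective_iff_map_eq_zero]
    intro q hq
    obtain ⟨u, rfl⟩ := Submodule.Quotient.mk_surjective _ q
    rw [Submodule.mapQ_apply, Submodule.Quotient.mk_eq_zero] at hq
    exact (Submodule.Quotient.mk_eq_zero _).2 hq
  · intro q
    obtain ⟨z, rfl⟩ := Submodule.Quotient.mk_surjective _ q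
    rw [Submodule.mapQ_apply, Submodule.Quotient.mk_eq_zero]
    constructor
    · rintro ⟨x, hx⟩
      have hker : (z : X) - i x ∈ LinearMap.ker a := by
        rw [LinearMap.mem_ker, map_sub, hcomm, hx, j_lift, sub_self]
      refine ⟨Submodule.Quotient.mk ⟨z - i x, hker⟩, ?_⟩
      rw [Submodule.mapQ_apply, Submodule.Quotient.eq]
      exact ⟨-x, by simp⟩
    · rintro ⟨p, hp⟩
      obtain ⟨u, rfl⟩ := Submodule.Quotient.mk_surjective _ p
      rw [Submodule.mapQ_apply, Submodule.Quotient.eq] at hp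
      obtain ⟨x, hx⟩ := hp
      refine ⟨-x, hj ?_⟩
      have hu : a u = 0 := u.2
      replace hx : i x = u - z := hx
      rw [j_lift, ← hcomm, map_neg, hx, map_neg, map_sub, hu]
      simp
  · intro q
    obtain ⟨y, rfl⟩ := Submodule.Quotient.mk_surjective _ q
    rw [Submodule.mapQ_apply, Submodule.Quotient.mk_eq_zero]
    constructor
    · rintro ⟨x, hx⟩
      refine ⟨Submodule.Quotient.mk ⟨x, y, hx.symm⟩, ?_⟩
      rw [Submodule.mapQ_apply]
      exact congrArg _ (hj ((j_lift _).trans hx))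
    · rintro ⟨p, hp⟩
      obtain ⟨z, rfl⟩ := Submodule.Quotient.mk_surjective _ p
      rw [Submodule.mapQ_apply, Submodule.Quotient.eq] at hp
      obtain ⟨x, hx⟩ := hp
      refine ⟨z - i x, ?_⟩
      rw [map_sub, hcomm, hx, map_sub, j_lift, sub_sub_cancel]
  · intro q
    obtain ⟨y, rfl⟩ := Submodule.Quotient.mk_surjective _ q
    obtain ⟨_, ⟨x, rfl⟩, _, ⟨y', rfl⟩, hy⟩ :=
      Submodule.mem_sup.1 (hsup ▸ Submodule.mem_top : y ∈ LinearMap.range a ⊔ LinearMap.range j)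
    refine ⟨Submodule.Quotient.mk y', ?_⟩
    rw [Submodule.mapQ_apply, Submodule.Quotient.eq]
    exact ⟨-x, by rw [map_neg, ← hy]; abel⟩

/-- If `p` is closed of finite codimension and no nonzero continuous functional vanishes on both
`p` and `q`, then `p ⊔ q = ⊤`. -/
theorem Submodule.sup_eq_top_of_isClosed_of_dual {E : Type*} [NormedAddCommGroup E]
    [NormedSpace ℝ E] (p q : Submodule ℝ E) (hp : IsClosed (p : Set E))
    [FiniteDimensional ℝ (E ⧸ p)]
    (h : ∀ f : E →L[ℝ] ℝ, (∀ x ∈ p, f x = 0) → (∀ x ∈ q, f x = 0) → f = 0) :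
    p ⊔ q = ⊤ := by
  by_contra hne
  have : IsClosed (p : Set E) := hp
  obtain ⟨y, -, hy⟩ := SetLike.exists_of_lt (lt_top_iff_ne_top.2 hne)
  have hy' : p.mkQ y ∉ q.map p.mkQ := by
    rwa [← Submodule.mem_comap, Submodule.comap_map_mkQ]
  obtain ⟨g, hg, hgq⟩ := Submodule.exists_dual_map_eq_bot_of_notMem hy' inferInstance
  let f : E →L[ℝ] ℝ := (LinearMap.toContinuousLinearMap g).comp p.mkQL
  have hf : f = 0 := by
    refine h f (fun x hx => ?_) fun x hx => ?_
    · change g (p.mkQ x) = 0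
      rw [Submodule.mkQ_apply, (Submodule.Quotient.mk_eq_zero p).2 hx, map_zero]
    · have : g (p.mkQ x) ∈ (q.map p.mkQ).map g :=
        Submodule.mem_map_of_mem (Submodule.mem_map_of_mem hx)
      rwa [hgq, Submodule.mem_bot] at this
  exact hg (DFunLike.congr_fun hf y)


/-- Key identity in the Fredholm index jump computation: with
`Z = A⁻¹(Y₊)`, one has
`dim(Z/(Z ∩ X₊)) = dim(ker A₋/(ker A₋ ∩ X₊)) + (codim_{Y₊} ran A₊ − codim_{Y₋} ran A₋)`. -/
theorem stmt_9
    (Xm Ym Xp Yp : Type*)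
    [NormedAddCommGroup Xm] [NormedSpace ℝ Xm] [CompleteSpace Xm]
    [NormedAddCommGroup Ym] [NormedSpace ℝ Ym] [CompleteSpace Ym]
    [NormedAddCommGroup Xp] [NormedSpace ℝ Xp] [CompleteSpace Xp]
    [NormedAddCommGroup Yp] [NormedSpace ℝ Yp] [CompleteSpace Yp]
    (i : Xp →L[ℝ] Xm) (j : Yp →L[ℝ] Ym)
    (hi : Function.Injective i) (hj : Function.Injective j)
    (Am : Xm →L[ℝ] Ym) (Ap : Xp →L[ℝ] Yp)
    (hcomm : ∀ x : Xp, Am (i x) = j (Ap x))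
    (hkerm : FiniteDimensional ℝ (LinearMap.ker (Am : Xm →ₗ[ℝ] Ym)))
    (hkerp : FiniteDimensional ℝ (LinearMap.ker (Ap : Xp →ₗ[ℝ] Yp)))
    (hranm : IsClosed ((LinearMap.range (Am : Xm →ₗ[ℝ] Ym) : Submodule ℝ Ym) : Set Ym))
    (hranp : IsClosed ((LinearMap.range (Ap : Xp →ₗ[ℝ] Yp) : Submodule ℝ Yp) : Set Yp))
    (hcokerm : FiniteDimensional ℝ (Ym ⧸ LinearMap.range (Am : Xm →ₗ[ℝ] Ym)))
    (hcokerp : FiniteDimensional ℝ (Yp ⧸ LinearMap.range (Ap : Xp →ₗ[ℝ] Yp)))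
    (hann : ∀ f : Ym →L[ℝ] ℝ, (∀ x : Xm, f (Am x) = 0) → (∀ y : Yp, f (j y) = 0) → f = 0)
    (Z : Submodule ℝ Xm)
    (hZ : Z = Submodule.comap (Am : Xm →ₗ[ℝ] Ym) (LinearMap.range (j : Yp →ₗ[ℝ] Ym)))
    (hfin : FiniteDimensional ℝ
      (↥Z ⧸ Submodule.comap Z.subtype (LinearMap.range (i : Xp →ₗ[ℝ] Xm)))) :
    (Module.finrank ℝ
        (↥Z ⧸ Submodule.comap Z.subtype (LinearMap.range (i : Xp →ₗ[ℝ] Xm))) : ℤ)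
      = Module.finrank ℝ
          (↥(LinearMap.ker (Am : Xm →ₗ[ℝ] Ym)) ⧸
            Submodule.comap (LinearMap.ker (Am : Xm →ₗ[ℝ] Ym)).subtype
              (LinearMap.range (i : Xp →ₗ[ℝ] Xm)))
        + ((Module.finrank ℝ (Yp ⧸ LinearMap.range (Ap : Xp →ₗ[ℝ] Yp)) : ℤ)
          - (Module.finrank ℝ (Ym ⧸ LinearMap.range (Am : Xm →ₗ[ℝ] Ym)) : ℤ)) := by
  subst hZ
  have hsup : LinearMap.range (Am : Xm →ₗ[ℝ] Ym) ⊔ LinearMap.range (j : Yp →ₗ[ℝ] Ym) = ⊤ :=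
    Submodule.sup_eq_top_of_isClosed_of_dual _ _ hranm fun f hf hg =>
      hann f (fun x => hf _ ⟨x, rfl⟩) fun y => hg _ ⟨y, rfl⟩
  have key := finrank_comap_range_quotient (i : Xp →ₗ[ℝ] Xm) (j : Yp →ₗ[ℝ] Ym) hj
    (Am : Xm →ₗ[ℝ] Ym) (Ap : Xp →ₗ[ℝ] Yp) hcomm hsup
  omega
end

section
/- Let γ ∈ (1,∞), ρ₀ > 0, c₀ > 0, and h(u) := ρ₀·((γ−1)u/c₀²)^{1/(γ−1)} for u > 0. Fix ξ ∈ ℝ², s ∈ ℝ, ρ_I > 0 and v_I ∈ ℝ². For v ∈ ℝ² with v ≠ v_I and E(v) := −s + ½|ξ|² − ½|v − ξ|² > 0, define ρ(v) := h(E(v)), z(v) := v − ξ, z_I := v_I − ξ, n(v) := (v_I − v)/|v_I − v|, t(v) := n(v) rotated by 90° counterclockwise, and G(v) := (ρ(v)·z(v) − ρ_I·z_I)·n(v). Suppose v̄ ≠ v_I satisfies E(v̄) > 0 and the mass relation ρ(v̄)·(z(v̄)·n(v̄)) = ρ_I·(z_I·n(v̄)), with z_I·n(v̄) ≠ 0.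 Then G is differentiable at v̄ with gradient ∇G(v̄) = ρ·[(1 − (z^n/c)²)·n̄ − z^t·(1/z_I^n + z^n/c²)·t̄], where n̄ := n(v̄), t̄ := t(v̄), ρ := ρ(v̄), z^n := z(v̄)·n̄, z^t := z(v̄)·t̄, z_I^n := z_I·n̄, and c² := (γ−1)·E(v̄). -/
/-- The polytropic enthalpy inverse satisfies `h' (u) = h (u) / ((γ - 1) u)`. -/
lemma hasDerivAt_polytropic_density {γ ρ0 c0 w : ℝ} (hγ : 1 < γ) (hc0 : 0 < c0) (hw : 0 < w) :
    HasDerivAt (fun w : ℝ => ρ0 * ((γ - 1) * w / c0 ^ 2) ^ (1 / (γ - 1)))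
      (ρ0 * ((γ - 1) * w / c0 ^ 2) ^ (1 / (γ - 1)) / ((γ - 1) * w)) w := by
  have hγ' : 0 < γ - 1 := sub_pos.2 hγ
  have hpos : 0 < (γ - 1) * w / c0 ^ 2 := by positivity
  have hlin : HasDerivAt (fun w : ℝ => (γ - 1) * w / c0 ^ 2) ((γ - 1) * 1 / c0 ^ 2) w :=
    ((hasDerivAt_id w).const_mul (γ - 1)).div_const _
  refine ((hlin.rpow_const (p := 1 / (γ - 1)) (Or.inl hpos.ne')).const_mul ρ0).congr_deriv ?_
  rw [Real.rpow_sub_one hpos.ne']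
  field_simp

/-- The derivative of `v ↦ 1 / |p - v|` away from `p`. -/
lemma hasFDerivAt_inv_sqrt_dist (p v : ℝ × ℝ) {d : ℝ} (hd : 0 < d)
    (hdv : (p.1 - v.1) ^ 2 + (p.2 - v.2) ^ 2 = d ^ 2) :
    HasFDerivAt (fun v : ℝ × ℝ => (Real.sqrt ((p.1 - v.1) ^ 2 + (p.2 - v.2) ^ 2))⁻¹)
      (((p.1 - v.1) / d ^ 3) • ContinuousLinearMap.fst ℝ ℝ ℝ
        + ((p.2 - v.2) / d ^ 3) • ContinuousLinearMap.snd ℝ ℝ ℝ) v := by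
  have h1 : HasFDerivAt (fun v : ℝ × ℝ => p.1 - v.1) (-ContinuousLinearMap.fst ℝ ℝ ℝ) v :=
    hasFDerivAt_fst.const_sub p.1
  have h2 : HasFDerivAt (fun v : ℝ × ℝ => p.2 - v.2) (-ContinuousLinearMap.snd ℝ ℝ ℝ) v :=
    hasFDerivAt_snd.const_sub p.2
  have hsqrt : Real.sqrt ((p.1 - v.1) ^ 2 + (p.2 - v.2) ^ 2) = d := by
    rw [hdv, Real.sqrt_sq hd.le]
  have hne : (p.1 - v.1) ^ 2 + (p.2 - v.2) ^ 2 ≠ 0 := by rw [hdv]; positivity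
  have h3 := ((h1.pow 2).add (h2.pow 2)).sqrt hne
  have h4 := (hasDerivAt_inv (x := Real.sqrt ((p.1 - v.1) ^ 2 + (p.2 - v.2) ^ 2))
    (by rw [hsqrt]; exact hd.ne')).comp_hasFDerivAt v h3
  refine h4.congr_fderiv ?_
  ext <;> simp [hsqrt] <;> field_simp


/-- Gradient of the self-similar Rankine–Hugoniot shock function: with
`ρ(v) = h(E(v))`, `z(v) = v − ξ`, `n(v) = (v_I − v)/|v_I − v|`, `t(v) = n(v)⊥` and
`G(v) = (ρ(v)z(v) − ρ_I z_I)·n(v)`, at a point `v̄` satisfying the mass relation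
`ρ z^n = ρ_I z_I^n` the function `G` is differentiable with gradient
`∇G(v̄) = ρ[(1 − (z^n/c)²)n̄ − z^t(1/z_I^n + z^n/c²)t̄]`, where `c² = (γ−1)E(v̄)`. -/
theorem stmt_12 (γ ρ0 c0 : ℝ) (hγ : 1 < γ) (hρ0 : 0 < ρ0) (hc0 : 0 < c0)
    (h : ℝ → ℝ) (hh : ∀ w : ℝ, h w = ρ0 * ((γ - 1) * w / c0 ^ 2) ^ (1 / (γ - 1)))
    (ξ : ℝ × ℝ) (s ρI : ℝ) (hρI : 0 < ρI) (vI : ℝ × ℝ)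
    (E : ℝ × ℝ → ℝ)
    (hE : ∀ v : ℝ × ℝ, E v = -s + (ξ.1 ^ 2 + ξ.2 ^ 2) / 2
        - ((v.1 - ξ.1) ^ 2 + (v.2 - ξ.2) ^ 2) / 2)
    (n : ℝ × ℝ → ℝ × ℝ)
    (hn : ∀ v : ℝ × ℝ, n v = (Real.sqrt ((vI.1 - v.1) ^ 2 + (vI.2 - v.2) ^ 2))⁻¹ • (vI - v))
    (G : ℝ × ℝ → ℝ)
    (hG : ∀ v : ℝ × ℝ, G v = (h (E v) * (v.1 - ξ.1) - ρI * (vI.1 - ξ.1)) * (n v).1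
        + (h (E v) * (v.2 - ξ.2) - ρI * (vI.2 - ξ.2)) * (n v).2)
    (vb : ℝ × ℝ) (hvb : vb ≠ vI) (hEpos : 0 < E vb)
    (nb tb : ℝ × ℝ) (hnb : nb = n vb) (htb : tb = (-nb.2, nb.1))
    (ρ zn zt zIn c2 : ℝ)
    (hρ : ρ = h (E vb))
    (hzn : zn = (vb.1 - ξ.1) * nb.1 + (vb.2 - ξ.2) * nb.2)
    (hzt : zt = (vb.1 - ξ.1) * tb.1 + (vb.2 - ξ.2) * tb.2)
    (hzIn : zIn = (vI.1 - ξ.1) * nb.1 + (vI.2 - ξ.2) * nb.2)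
    (hc2 : c2 = (γ - 1) * E vb)
    (hmass : ρ * zn = ρI * zIn) (hzIn0 : zIn ≠ 0)
    (g : ℝ × ℝ)
    (hg : g = ρ • ((1 - zn ^ 2 / c2) • nb - (zt * (1 / zIn + zn / c2)) • tb)) :
    HasFDerivAt G
      (g.1 • ContinuousLinearMap.fst ℝ ℝ ℝ + g.2 • ContinuousLinearMap.snd ℝ ℝ ℝ) vb := by
  have hγ' : 0 < γ - 1 := sub_pos.2 hγ
  obtain ⟨d, hd, hdv⟩ : ∃ d : ℝ, 0 < d ∧ (vI.1 - vb.1) ^ 2 + (vI.2 - vb.2) ^ 2 = d ^ 2 := by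
    have hpos : 0 < (vI.1 - vb.1) ^ 2 + (vI.2 - vb.2) ^ 2 := by
      by_contra! hle
      refine hvb (Prod.ext ?_ ?_) <;> nlinarith [sq_nonneg (vI.1 - vb.1), sq_nonneg (vI.2 - vb.2)]
    exact ⟨_, Real.sqrt_pos.2 hpos, (Real.sq_sqrt hpos.le).symm⟩
  have hsqrt : Real.sqrt ((vI.1 - vb.1) ^ 2 + (vI.2 - vb.2) ^ 2) = d := by
    rw [hdv, Real.sqrt_sq hd.le]
  have hr := hasFDerivAt_inv_sqrt_dist vI vb hd hdv
  have hfst : HasFDerivAt (fun v : ℝ × ℝ => v.1) (ContinuousLinearMap.fst ℝ ℝ ℝ) vb :=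
    hasFDerivAt_fst
  have hsnd : HasFDerivAt (fun v : ℝ × ℝ => v.2) (ContinuousLinearMap.snd ℝ ℝ ℝ) vb :=
    hasFDerivAt_snd
  have hE' : HasFDerivAt E ((-(vb.1 - ξ.1)) • ContinuousLinearMap.fst ℝ ℝ ℝ
      + (-(vb.2 - ξ.2)) • ContinuousLinearMap.snd ℝ ℝ ℝ) vb := by
    rw [funext hE]
    refine (((((hfst.sub_const ξ.1).pow 2).add ((hsnd.sub_const ξ.2).pow 2)).mul_const
      (2 : ℝ)⁻¹).const_sub (-s + (ξ.1 ^ 2 + ξ.2 ^ 2) / 2)).congr_fderiv ?_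
    ext <;> simp
  have hh' : HasDerivAt h (ρ / c2) (E vb) := by
    rw [hρ, hc2, hh, funext hh]
    exact hasDerivAt_polytropic_density hγ hc0 hEpos
  have hρ' := hh'.comp_hasFDerivAt vb hE'
  have hG' := (((hρ'.mul (hfst.sub_const ξ.1)).sub_const (ρI * (vI.1 - ξ.1))).mul
      (hr.mul (hfst.const_sub vI.1))).add
    (((hρ'.mul (hsnd.sub_const ξ.2)).sub_const (ρI * (vI.2 - ξ.2))).mul
      (hr.mul (hsnd.const_sub vI.2)))
  have hGfun : G = fun v => (h (E v) * (v.1 - ξ.1) - ρI * (vI.1 - ξ.1)) *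
        ((Real.sqrt ((vI.1 - v.1) ^ 2 + (vI.2 - v.2) ^ 2))⁻¹ * (vI.1 - v.1))
      + (h (E v) * (v.2 - ξ.2) - ρI * (vI.2 - ξ.2)) *
        ((Real.sqrt ((vI.1 - v.1) ^ 2 + (vI.2 - v.2) ^ 2))⁻¹ * (vI.2 - v.2)) := by
    funext v
    simp [hG, hn]
  rw [hGfun]
  refine HasFDerivAt.congr_fderiv hG' ?_
  have hc2' : c2 ≠ 0 := by rw [hc2]; positivity
  have hn1 : vI.1 - vb.1 = d * nb.1 := by
    rw [hnb, hn, hsqrt]; simp; field_simp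
  have hn2 : vI.2 - vb.2 = d * nb.2 := by
    rw [hnb, hn, hsqrt]; simp; field_simp
  have hunit : nb.1 ^ 2 + nb.2 ^ 2 = 1 := by
    rw [hn1, hn2] at hdv
    have : d ^ 2 ≠ 0 := by positivity
    apply mul_left_cancel₀ this
    linarith
  have hI1 : vI.1 - ξ.1 = (vb.1 - ξ.1) + d * nb.1 := by linarith
  have hI2 : vI.2 - ξ.2 = (vb.2 - ξ.2) + d * nb.2 := by linarith
  have hzIn' : zIn = zn + d := by
    rw [hzIn, hzn, hI1, hI2]; linear_combination d * hunit
  have hρI' : ρI = ρ * zn / zIn := by field_simp; linarith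
  subst htb
  simp only at hzt
  have hx : vb.1 - ξ.1 = zn * nb.1 - zt * nb.2 := by
    rw [hzn, hzt]; linear_combination (-(vb.1 - ξ.1)) * hunit
  have hy : vb.2 - ξ.2 = zn * nb.2 + zt * nb.1 := by
    rw [hzn, hzt]; linear_combination (-(vb.2 - ξ.2)) * hunit
  have hx' : ξ.1 - vb.1 = -(zn * nb.1 - zt * nb.2) := by linarith
  have hy' : ξ.2 - vb.2 = -(zn * nb.2 + zt * nb.1) := by linarith
  ext
  · simp [hsqrt, hg, ← hρ]
    rw [hI1, hI2, hn1, hn2, hx, hy, hρI']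
    field_simp
    rw [hx', hzIn']
    grind
  · simp [hsqrt, hg, ← hρ]
    rw [hI1, hI2, hn1, hn2, hx, hy, hρI']
    field_simp
    rw [hy', hzIn']
    grind
end
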